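/- arXiv:math/0504057 — 3 statements merged into one kernel-verified Lean document; each statement's English description precedes it below -/
import Mathlib

section
/- Let Ω ⊂ ℝⁿ (n ≥ 2) be a bounded open set, let 2n/(n+1) ≤ p < 2, T > 0, and let V : Ω → ℝ be continuous. Suppose u : Ω × (0, T) → ℝ is positive, continuously differentiable in t, twice continuously differentiable in x, the vector field x ↦ ‖∇u(x,t)‖^{p−2} ∇u(x,t) is continuously differentiable in x for each t (interpreted as 0 where ∇u = 0), u satisfies pointwise on Ω × (0, T): ∂u/∂t = div(‖∇u‖^{p−2} ∇u) + V u^{p−1}, and sup_{t ∈ (0,T)} ∫_Ω u(x, t) dx < ∞. Then for every ε ∈ (0, 1) there exists a constant C < ∞ such that for all φ ∈ C_c^∞(Ω): ∫_Ω (1−ε) V |φ|^p dx − ∫_Ω ‖∇φ‖^p dx ≤ C ∫_Ω |φ|^p dx. In particular, if the quantity σ = inf over nonzero φ ∈ C_c^∞(Ω) of (∫_Ω ‖∇φ‖^p dx − ∫_Ω (1−ε)V |φ|^p dx) / (∫_Ω |φ|^p dx) equals −∞ for some ε > 0, then no such positive solution exists. -/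
open MeasureTheory Set

/-- The vector field `‖∇u‖^{p−2} ∇u` (equal to the zero vector wherever
`∇u = 0`, by the `Real.rpow` convention `0^{p-2} = 0` for `p ≠ 2`). -/
noncomputable def pVF {n : ℕ} (p : ℝ) (u : EuclideanSpace ℝ (Fin n) → ℝ)
    (x : EuclideanSpace ℝ (Fin n)) : EuclideanSpace ℝ (Fin n) :=
  ‖gradient u x‖ ^ (p - 2) • gradient u x

/-- The p-Laplacian `Δ_p u = div(‖∇u‖^{p−2} ∇u)`. -/
noncomputable def pLaplacian {n : ℕ} (p : ℝ) (u : EuclideanSpace ℝ (Fin n) → ℝ)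
    (x : EuclideanSpace ℝ (Fin n)) : ℝ :=
  ∑ i : Fin n, fderiv ℝ (pVF p u) x (EuclideanSpace.single i 1) i

/-- The (endpoints of the) bounded connected components of a set of reals. -/
abbrev Gap (O : Set ℝ) : Type :=
  {c : ℝ × ℝ // c.1 < c.2 ∧ Ioo c.1 c.2 ⊆ O ∧ c.1 ∉ O ∧ c.2 ∉ O}

lemma Gap.pairwise_disjoint (O : Set ℝ) :
    Pairwise (Function.onFun Disjoint fun c : Gap O => Ioo c.1.1 c.1.2) := by
  rintro ⟨⟨a, b⟩, hab, hs, ha, hb⟩ ⟨⟨a', b'⟩, hab', hs', ha', hb'⟩ hne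
  rw [Function.onFun, Set.disjoint_left]
  rintro x ⟨h1, h2⟩ ⟨h3, h4⟩
  simp only at *
  apply hne
  have e1 : a = a' := by
    rcases lt_trichotomy a a' with h | h | h
    · exact absurd (hs ⟨h, by linarith⟩) ha'
    · exact h
    · exact absurd (hs' ⟨h, by linarith⟩) ha
  have e2 : b = b' := by
    rcases lt_trichotomy b b' with h | h | h
    · exact absurd (hs' ⟨by linarith, h⟩) hb
    · exact h
    · exact absurd (hs ⟨by linarith, h⟩) hb'
  simp [e1, e2]

instance Gap.countable (O : Set ℝ) : Countable (Gap O) :=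
  (Gap.pairwise_disjoint O).countable_of_isOpen_disjoint (fun _ => isOpen_Ioo)
    fun c => nonempty_Ioo.2 c.2.1

lemma Gap.iUnion_eq {O : Set ℝ} {r t : ℝ} (hO : IsOpen O) (hsub : O ⊆ Ioo r t) :
    ⋃ c : Gap O, Ioo c.1.1 c.1.2 = O := by
  apply Subset.antisymm (iUnion_subset fun c => c.2.2.1)
  intro x hx
  have hxr := hsub hx
  set A := Oᶜ ∩ Iic x
  set B := Oᶜ ∩ Ici x
  have hA : sSup A ∈ A := (hO.isClosed_compl.inter isClosed_Iic).csSup_mem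
    ⟨r, fun h => (lt_irrefl _ (hsub h).1), hxr.1.le⟩ ⟨x, fun y hy => hy.2⟩
  have hB : sInf B ∈ B := (hO.isClosed_compl.inter isClosed_Ici).csInf_mem
    ⟨t, fun h => (lt_irrefl _ (hsub h).2), hxr.2.le⟩ ⟨x, fun y hy => hy.2⟩
  have hAx : sSup A < x := lt_of_le_of_ne hA.2 fun h => hA.1 (h ▸ hx)
  have hBx : x < sInf B := lt_of_le_of_ne hB.2 fun h => hB.1 (h ▸ hx)
  refine mem_iUnion.2 ⟨⟨(sSup A, sInf B), hAx.trans hBx, ?_, hA.1, hB.1⟩, hAx, hBx⟩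
  rintro y ⟨hy1, hy2⟩
  by_contra hy
  rcases le_total y x with h | h
  · exact absurd (le_csSup ⟨x, fun z hz => hz.2⟩ (show y ∈ A from ⟨hy, h⟩)) (not_le.2 hy1)
  · exact absurd (csInf_le ⟨x, fun z hz => hz.2⟩ (show y ∈ B from ⟨hy, h⟩)) (not_le.2 hy2)

lemma Gap.mem_Icc {O : Set ℝ} {r t : ℝ} (hsub : O ⊆ Ioo r t) (c : Gap O) :
    r ≤ c.1.1 ∧ c.1.2 ≤ t := by
  have := c.2.2.1.trans hsub
  exact (Ioo_subset_Ioo_iff c.2.1).1 this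

/-- The increments over the gaps sum to the integral of the derivative over the open set. -/
lemma Gap.hasSum_integral {O : Set ℝ} {r t : ℝ} (hO : IsOpen O) (hsub : O ⊆ Ioo r t)
    {e : ℝ → ℝ} (he : IntegrableOn e (Ioo r t)) :
    HasSum (fun c : Gap O => ∫ τ in c.1.1..c.1.2, e τ) (∫ τ in O, e τ) := by
  have h := hasSum_integral_iUnion (μ := volume) (f := e)
    (s := fun c : Gap O => Ioo c.1.1 c.1.2) (fun _ => measurableSet_Ioo)
    (Gap.pairwise_disjoint O) (by rw [Gap.iUnion_eq hO hsub]; exact he.mono_set hsub)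
  rw [Gap.iUnion_eq hO hsub] at h
  have hc : (fun c : Gap O => ∫ τ in c.1.1..c.1.2, e τ) =
      fun c : Gap O => ∫ τ in Ioo c.1.1 c.1.2, e τ := by
    funext c
    rw [intervalIntegral.integral_of_le c.2.1.le, integral_Ioc_eq_integral_Ioo]
  rw [hc]
  exact h

lemma Gap.summable_length {O : Set ℝ} {r t : ℝ} (hO : IsOpen O) (hsub : O ⊆ Ioo r t) :
    HasSum (fun c : Gap O => c.1.2 - c.1.1) (∫ _τ in O, (1 : ℝ)) := by
  have := Gap.hasSum_integral hO hsub (e := fun _ => (1 : ℝ)) (by simp)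
  simpa using this

/-- A function that is monotone near every point of an open interval and continuous up to the
endpoints is monotone. -/
lemma le_of_locally_monotone {F : ℝ → ℝ} {a b : ℝ} (hab : a < b) (hF : ContinuousOn F (Icc a b))
    (h : ∀ τ ∈ Ioo a b, ∃ δ > 0, MonotoneOn F (Ioo (τ - δ) (τ + δ))) : F a ≤ F b := by
  have key : ∀ r ∈ Ioo a b, F r ≤ F b := by
    intro r hr
    have hsub : Icc r b ⊆ {x | F r ≤ F x} := by
      apply IsClosed.Icc_subset_of_forall_exists_gt (a := r) (b := b)
      · have : ContinuousOn F (Icc r b) := hF.mono (Icc_subset_Icc hr.1.le le_rfl)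
        have := this.preimage_isClosed_of_isClosed isClosed_Icc (isClosed_Ici (a := F r))
        rw [inter_comm]; exact this
      · exact le_refl (F r)
      · rintro x ⟨hx1, hx2⟩ y hy
        obtain ⟨δ, hδ, hm⟩ := h x ⟨by linarith [hr.1, hx2.1], hx2.2⟩
        have hlt : x < min y (x + δ / 2) := lt_min hy (by linarith)
        refine ⟨min y (x + δ / 2), ?_, hlt, min_le_left _ _⟩
        have := min_le_right y (x + δ / 2)
        exact le_trans (show F r ≤ F x from hx1)
          (hm ⟨by linarith, by linarith⟩ ⟨by linarith, by linarith⟩ hlt.le)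
    exact hsub ⟨hr.2.le, le_rfl⟩
  have hc : Filter.Tendsto F (nhdsWithin a (Ioo a b)) (nhds (F a)) :=
    (hF a ⟨le_rfl, hab.le⟩).mono Ioo_subset_Icc_self
  have : (nhdsWithin a (Ioo a b)).NeBot := by
    rw [nhdsWithin_Ioo_eq_nhdsGT hab]; infer_instance
  exact le_of_tendsto hc (Filter.eventually_of_mem self_mem_nhdsWithin key)

lemma intervalIntegral_deriv_posPart {z e : ℝ → ℝ} {a b : ℝ} 
    (hz : ∀ τ ∈ uIcc a b, HasDerivAt z (e τ) τ) (he : ContinuousOn e (uIcc a b)) :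
    ∫ τ in a..b, (if 0 < z τ then e τ else 0) = max (z b) 0 - max (z a) 0 := by
  obtain ⟨C, hC⟩ := isCompact_uIcc.exists_bound_of_continuousOn he
  have hC0 : 0 ≤ C := (norm_nonneg _).trans (hC a left_mem_uIcc)
  have hlip : LipschitzOnWith ⟨C, hC0⟩ z (uIcc a b) :=
    (convex_uIcc a b).lipschitzOnWith_of_nnnorm_hasDerivWithin_le
      (fun τ hτ => (hz τ hτ).hasDerivWithinAt) (fun τ hτ => hC τ hτ)
  have hlip2 : LipschitzOnWith ⟨C, hC0⟩ (fun τ => max (z τ) 0) (uIcc a b) := by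
    intro x hx y hy
    refine le_trans ?_ (hlip hx hy)
    rw [edist_dist, edist_dist]
    apply ENNReal.ofReal_le_ofReal
    rw [Real.dist_eq, Real.dist_eq]
    exact abs_max_sub_max_le_abs _ _ _
  rw [← (hlip2.absolutelyContinuousOnInterval).integral_deriv_eq_sub]
  apply intervalIntegral.integral_congr
  intro τ hτ
  have hd := hz τ hτ
  rcases lt_trichotomy (z τ) 0 with h | h | h
  · have : (fun τ => max (z τ) 0) =ᶠ[nhds τ] fun _ => 0 := by
      filter_upwards [hd.continuousAt.eventually_lt_const h] with s hs
      exact max_eq_right hs.le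
    simp [this.deriv_eq, h.not_gt]
  · have : IsLocalMin (fun τ => max (z τ) 0) τ := by
      refine Filter.Eventually.of_forall fun s => ?_
      simp [h]
    simp [this.deriv_eq_zero, h]
  · have : (fun τ => max (z τ) 0) =ᶠ[nhds τ] z := by
      filter_upwards [hd.continuousAt.eventually_const_lt h] with s hs
      exact max_eq_left hs.le
    simp [this.deriv_eq, h, hd.deriv]

section
variable {X : Type*} [MeasurableSpace X] {μ : Measure X} [IsFiniteMeasure μ]

lemma increment_eq_gaps {y e : ℝ → ℝ} {r t : ℝ} {O : Set ℝ} (hrt : r ≤ t)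
    (hO : IsOpen O) (hsub : O ⊆ Ioo r t)
    (hFTC : ∀ a b, r ≤ a → a ≤ b → b ≤ t → ∫ τ in a..b, e τ = y b - y a)
    (hint : IntegrableOn e (Ioo r t)) :
    HasSum (fun c : Gap O => y c.1.2 - y c.1.1) (y t - y r - ∫ τ in Ioo r t \ O, e τ) := by
  have h := Gap.hasSum_integral hO hsub hint
  have h1 : (fun c : Gap O => ∫ τ in c.1.1..c.1.2, e τ) =
      fun c : Gap O => y c.1.2 - y c.1.1 := by
    funext c
    have := Gap.mem_Icc hsub c
    exact hFTC _ _ this.1 c.2.1.le this.2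
  have h2 : ∫ τ in Ioo r t, e τ = y t - y r := by
    rw [← hFTC r t le_rfl hrt le_rfl, intervalIntegral.integral_of_le hrt,
      integral_Ioc_eq_integral_Ioo]
  have h3 := setIntegral_sdiff hO.measurableSet hint hsub
  rw [h1] at h
  rw [h3, h2]
  convert h using 1
  ring

lemma integrable_prod_of_bound {e : ℝ → X → ℝ} {r t N : ℝ} {S : Set ℝ} (hS : MeasurableSet S)
    (hsub : S ⊆ Ioo r t) (hme : Measurable (Function.uncurry e))
    (hbd : ∀ τ ∈ S, ∀ x, |e τ x| ≤ N) :
    Integrable (Function.uncurry fun (x : X) (τ : ℝ) => e τ x)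
      (μ.prod (volume.restrict S)) := by
  have : IsFiniteMeasure (volume.restrict S) :=
    ⟨by
      rw [Measure.restrict_apply_univ]
      exact (measure_mono hsub).trans_lt (by simp)⟩
  refine Integrable.of_bound (C := N) (hme.comp measurable_swap).aestronglyMeasurable ?_
  have h1 : ∀ᵐ z ∂(μ.prod (volume.restrict S)), z.2 ∈ S := by
    have : μ.prod (volume.restrict S) = (μ.prod volume).restrict (univ ×ˢ S) := by
      rw [← Measure.prod_restrict, Measure.restrict_univ]
    rw [this]
    filter_upwards [ae_restrict_mem (MeasurableSet.univ.prod hS)] with z hz using hz.2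
  filter_upwards [h1] with z hz using hbd _ hz _

/-- If the integrated increments over the gaps are controlled, and the derivative is controlled
off the gaps, then the total increment is controlled. -/
lemma integral_increment_le {y e : ℝ → X → ℝ} {r t N C : ℝ} {O : Set ℝ} (hrt : r ≤ t)
    (hO : IsOpen O) (hsub : O ⊆ Ioo r t)
    (hFTC : ∀ x a b, r ≤ a → a ≤ b → b ≤ t → ∫ τ in a..b, e τ x = y b x - y a x)
    (hint : ∀ x, IntegrableOn (fun τ => e τ x) (Ioo r t))
    (hme : Measurable (Function.uncurry e))
    (hbd : ∀ τ ∈ Ioo r t \ O, ∀ x, |e τ x| ≤ N)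
    (hy : ∀ τ ∈ Icc r t, Integrable (y τ) μ)
    (hsum : Summable fun c : Gap O => ∫ x, |y c.1.2 x - y c.1.1 x| ∂μ)
    (hC : ∀ τ ∈ Ioo r t \ O, ∫ x, e τ x ∂μ ≤ C)
    (hgap : ∀ c : Gap O, ∫ x, y c.1.2 x ∂μ - ∫ x, y c.1.1 x ∂μ ≤ C * (c.1.2 - c.1.1)) :
    ∫ x, y t x ∂μ - ∫ x, y r x ∂μ ≤ C * (t - r) := by
  have hmem : ∀ c : Gap O, c.1.1 ∈ Icc r t ∧ c.1.2 ∈ Icc r t := fun c => by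
    have := Gap.mem_Icc hsub c
    have := c.2.1
    constructor <;> constructor <;> linarith
  have hS : MeasurableSet (Ioo r t \ O) := measurableSet_Ioo.diff hO.measurableSet
  have hprod := integrable_prod_of_bound (μ := μ) hS sdiff_subset hme hbd
  have hpt := fun x => increment_eq_gaps hrt hO hsub (hFTC x) (hint x)
  have hΔ : ∀ c : Gap O, Integrable (fun x => y c.1.2 x - y c.1.1 x) μ := fun c =>
    (hy _ (hmem c).2).sub (hy _ (hmem c).1)
  have hs := hasSum_integral_of_summable_integral_norm hΔ hsum
  have e1 : ∫ x, ∑' c : Gap O, (y c.1.2 x - y c.1.1 x) ∂μ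
      = ∫ x, y t x ∂μ - ∫ x, y r x ∂μ - ∫ τ in Ioo r t \ O, ∫ x, e τ x ∂μ := by
    have := integral_integral_swap hprod
    rw [← this, ← integral_sub (hy t ⟨hrt, le_rfl⟩) (hy r ⟨le_rfl, hrt⟩), ← integral_sub]
    · exact integral_congr_ae (Filter.Eventually.of_forall fun x => (hpt x).tsum_eq)
    · exact (hy t ⟨hrt, le_rfl⟩).sub (hy r ⟨le_rfl, hrt⟩)
    · exact hprod.integral_prod_left
  rw [e1] at hs
  have hlen := (Gap.summable_length hO hsub).mul_left C
  have h1 := hasSum_le (fun c => by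
    rw [integral_sub (hy _ (hmem c).2) (hy _ (hmem c).1)]
    exact hgap c) hs hlen
  have hfin : volume (Ioo r t \ O) ≠ ⊤ :=
    ((measure_mono sdiff_subset).trans_lt (by simp : volume (Ioo r t) < ⊤)).ne
  have h2 : ∫ τ in Ioo r t \ O, ∫ x, e τ x ∂μ ≤ ∫ τ in Ioo r t \ O, C := by
    apply setIntegral_mono_on hprod.integral_prod_right (integrableOn_const hfin) hS hC
  have h3 : ∫ τ in Ioo r t \ O, C = C * (t - r) - C * ∫ _τ in O, (1 : ℝ) := by
    rw [setIntegral_sdiff hO.measurableSet (integrableOn_const (by simp)) hsub]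
    simp [hrt, mul_comm]
  linarith

lemma summable_integral_abs_increment {y e : ℝ → X → ℝ} {r t N C : ℝ} {O : Set ℝ} (hrt : r ≤ t)
    (hO : IsOpen O) (hsub : O ⊆ Ioo r t)
    (hFTC : ∀ x a b, r ≤ a → a ≤ b → b ≤ t → ∫ τ in a..b, e τ x = y b x - y a x)
    (hint : ∀ x, IntegrableOn (fun τ => e τ x) (Ioo r t))
    (hme : Measurable (Function.uncurry e))
    (hbd : ∀ τ ∈ Ioo r t \ O, ∀ x, |e τ x| ≤ N)
    (hy : ∀ τ ∈ Icc r t, Integrable (y τ) μ)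
    (hgap : ∀ c : Gap O, ∫ x, max (y c.1.1 x - y c.1.2 x) 0 ∂μ ≤ C * (c.1.2 - c.1.1)) :
    Summable fun c : Gap O => ∫ x, |y c.1.2 x - y c.1.1 x| ∂μ := by
  have hmem : ∀ c : Gap O, c.1.1 ∈ Icc r t ∧ c.1.2 ∈ Icc r t := fun c => by
    have := Gap.mem_Icc hsub c
    have := c.2.1
    constructor <;> constructor <;> linarith
  have hS : MeasurableSet (Ioo r t \ O) := measurableSet_Ioo.diff hO.measurableSet
  have hprod := integrable_prod_of_bound (μ := μ) hS sdiff_subset hme hbd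
  have hpt := fun x => increment_eq_gaps hrt hO hsub (hFTC x) (hint x)
  have hΔ : ∀ c : Gap O, Integrable (fun x => y c.1.2 x - y c.1.1 x) μ := fun c =>
    (hy _ (hmem c).2).sub (hy _ (hmem c).1)
  have hneg : ∀ c : Gap O, Integrable (fun x => max (y c.1.1 x - y c.1.2 x) 0) μ := fun c =>
    ((hy _ (hmem c).1).sub (hy _ (hmem c).2)).pos_part
  have hlen := (Gap.summable_length hO hsub).mul_left C
  have hm : Summable fun c : Gap O => ∫ x, max (y c.1.1 x - y c.1.2 x) 0 ∂μ :=
    Summable.of_nonneg_of_le (fun c => integral_nonneg fun x => le_max_right _ _) hgap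
      hlen.summable
  have hD : Integrable (fun x => y t x - y r x - ∫ τ in Ioo r t \ O, e τ x) μ :=
    ((hy t ⟨hrt, le_rfl⟩).sub (hy r ⟨le_rfl, hrt⟩)).sub hprod.integral_prod_left
  set D := fun x => y t x - y r x - ∫ τ in Ioo r t \ O, e τ x with hDdef
  have hmE : ∑' c : Gap O, ∫⁻ x, ENNReal.ofReal (max (y c.1.1 x - y c.1.2 x) 0) ∂μ ≠ ⊤ := by
    have : (fun c : Gap O => ∫⁻ x, ENNReal.ofReal (max (y c.1.1 x - y c.1.2 x) 0) ∂μ) =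
        fun c : Gap O => ENNReal.ofReal (∫ x, max (y c.1.1 x - y c.1.2 x) 0 ∂μ) := by
      funext c
      rw [ofReal_integral_eq_lintegral_ofReal (hneg c)
        (Filter.Eventually.of_forall fun x => le_max_right _ _)]
    rw [this]
    exact hm.tsum_ofReal_ne_top
  have hpw : ∀ x, ∑' c : Gap O, ‖y c.1.2 x - y c.1.1 x‖ₑ ≤
      ‖D x‖ₑ + 2 * ∑' c : Gap O, ENNReal.ofReal (max (y c.1.1 x - y c.1.2 x) 0) := by
    intro x
    have h1 : Summable fun c : Gap O => y c.1.2 x - y c.1.1 x := (hpt x).summable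
    have h2 : Summable fun c : Gap O => max (y c.1.1 x - y c.1.2 x) 0 := by
      refine Summable.of_nonneg_of_le (fun c => le_max_right _ _) (fun c => ?_) h1.norm
      rw [Real.norm_eq_abs, abs_sub_comm]
      exact max_le (le_abs_self _) (abs_nonneg _)
    have h3 : (fun c : Gap O => |y c.1.2 x - y c.1.1 x|) =
        fun c : Gap O => (y c.1.2 x - y c.1.1 x) + 2 * max (y c.1.1 x - y c.1.2 x) 0 := by
      funext c
      rcases le_total (y c.1.1 x) (y c.1.2 x) with h | h
      · rw [abs_of_nonneg (by linarith), max_eq_right (by linarith)]; ring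
      · rw [abs_of_nonpos (by linarith), max_eq_left (by linarith)]; ring
    have h4 : ∑' c : Gap O, |y c.1.2 x - y c.1.1 x| =
        D x + 2 * ∑' c : Gap O, max (y c.1.1 x - y c.1.2 x) 0 := by
      rw [h3, h1.tsum_add (h2.mul_left 2), tsum_mul_left, (hpt x).tsum_eq]
    simp only [Real.enorm_eq_ofReal_abs]
    rw [← ENNReal.ofReal_tsum_of_nonneg (fun c => abs_nonneg _) h1.abs, h4,
      ← ENNReal.ofReal_tsum_of_nonneg (fun c => le_max_right _ _) h2]
    refine ENNReal.ofReal_add_le.trans ?_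
    gcongr
    · exact le_abs_self _
    · rw [ENNReal.ofReal_mul (by norm_num)]
      simp
  have hE : ∑' c : Gap O, ∫⁻ x, ‖y c.1.2 x - y c.1.1 x‖ₑ ∂μ ≠ ⊤ := by
    rw [← lintegral_tsum fun c => (hΔ c).1.enorm]
    refine ne_top_of_le_ne_top ?_ (lintegral_mono hpw)
    rw [lintegral_add_left' hD.1.enorm, lintegral_const_mul' _ _ (by norm_num),
      lintegral_tsum fun c => (hneg c).1.aemeasurable.ennreal_ofReal]
    exact ENNReal.add_ne_top.2 ⟨hD.2.ne, ENNReal.mul_ne_top (by norm_num) hmE⟩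
  convert ENNReal.summable_toReal hE using 2 with c
  exact integral_norm_eq_lintegral_enorm (hΔ c).1
end

section
variable {X : Type*} [MeasurableSpace X] {μ : Measure X} [IsFiniteMeasure μ]

/-- A nonnegative function `a` of time and space which is `C¹` in time, with time derivative `f`,
without any joint regularity besides measurability. -/
structure SeparateEvolution (μ : Measure X) (T : ℝ) (a f : ℝ → X → ℝ) : Prop where
  hasDerivAt : ∀ τ ∈ Ioo 0 T, ∀ x, HasDerivAt (fun σ => a σ x) (f τ x) τ
  continuousOn : ∀ x, ContinuousOn (fun τ => f τ x) (Ioo 0 T)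
  measurable_deriv : Measurable (Function.uncurry f)
  measurable : Measurable (Function.uncurry a)
  nonneg : ∀ τ ∈ Ioo 0 T, ∀ x, 0 ≤ a τ x
  integrable : ∀ τ ∈ Ioo 0 T, Integrable (a τ) μ
  bounded : ∀ τ ∈ Ioo 0 T, ∃ N : ℕ, ∀ x, |f τ x| ≤ N
  continuousOn_integral : ContinuousOn (fun τ => ∫ x, a τ x ∂μ) (Ioo 0 T)

namespace SeparateEvolution

variable {T : ℝ} {a f : ℝ → X → ℝ}

omit [IsFiniteMeasure μ] in
lemma continuousOn_integral_posPart (h : SeparateEvolution μ T a f) {s : ℝ} (hs : s ∈ Ioo 0 T) :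
    ContinuousOn (fun τ => ∫ x, max (a s x - a τ x) 0 ∂μ) (Ioo 0 T) := by
  intro τ hτ
  have hm : ∀ σ, Measurable (a σ) := fun σ => h.measurable.comp measurable_prodMk_left
  apply tendsto_integral_filter_of_dominated_convergence (a s)
  · exact Filter.Eventually.of_forall fun σ =>
      (((hm s).sub (hm σ)).max measurable_const).aestronglyMeasurable
  · filter_upwards [self_mem_nhdsWithin] with σ hσ
    refine Filter.Eventually.of_forall fun x => ?_
    rw [Real.norm_eq_abs, abs_of_nonneg (le_max_right _ _)]
    exact max_le (by linarith [h.nonneg σ hσ x]) (h.nonneg s hs x)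
  · exact h.integrable s hs
  · refine Filter.Eventually.of_forall fun x => ?_
    have := (h.hasDerivAt τ hτ x).continuousAt.continuousWithinAt (s := Ioo 0 T)
    exact Filter.Tendsto.max (Filter.Tendsto.const_sub _ this) tendsto_const_nhds

/-- The increments of `∫ a` are bounded below as soon as the integrals of the time derivative are,
provided that the integrals of `-∂ₜa` over the sets `{a t < a s}` are controlled in terms of the
supremum of `∂ₜa` at time `s`. The exceptional times are handled with a Baire category argument. -/
theorem mul_le_integral_sub (h : SeparateEvolution μ T a f) {A : ℝ} {C : ℕ → ℝ}
    (hA : ∀ τ ∈ Ioo 0 T, A ≤ ∫ x, f τ x ∂μ)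
    (hC : ∀ N : ℕ, ∀ s ∈ Ioo 0 T, (∀ x, |f s x| ≤ N) → ∀ τ ∈ Ioo 0 T,
      ∫ x, (if 0 < a s x - a τ x then -f τ x else 0) ∂μ ≤ C N)
    {r t : ℝ} (hr : r ∈ Ioo 0 T) (ht : t ∈ Ioo 0 T) (hrt : r < t) :
    A * (t - r) ≤ ∫ x, a t x ∂μ - ∫ x, a r x ∂μ := by
  set H : ℝ → ℝ → ℝ := fun s τ => ∫ x, max (a s x - a τ x) 0 ∂μ with hH
  set Φ : ℝ → ℝ := fun τ => ∫ x, a τ x ∂μ - A * τ with hΦ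
  set 𝓕 : Set (ℝ → ℝ) := {F | F = Φ ∨ ∃ (N : ℕ) (s : ℝ), s ∈ Ioo 0 T ∧ (∀ x, |f s x| ≤ N) ∧
    F = fun τ => C N * τ - H s τ} with h𝓕
  have hcont : ∀ F ∈ 𝓕, ContinuousOn F (Ioo 0 T) := by
    rintro F (rfl | ⟨N, s, hs, -, rfl⟩)
    · exact h.continuousOn_integral.sub (by fun_prop)
    · exact ContinuousOn.sub (by fun_prop) (h.continuousOn_integral_posPart hs)
  set D : Set ℝ := {τ | ∃ δ > 0, ∀ F ∈ 𝓕, MonotoneOn F (Ioo (τ - δ) (τ + δ))} with hD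
  have hDo : IsOpen D := by
    rw [Metric.isOpen_iff]
    rintro τ ⟨δ, hδ, hm⟩
    refine ⟨δ / 2, by positivity, fun σ hσ => ⟨δ / 2, by positivity, fun F hF =>
      (hm F hF).mono ?_⟩⟩
    rw [Metric.mem_ball, Real.dist_eq, abs_lt] at hσ
    exact Ioo_subset_Ioo (by linarith) (by linarith)
  have hglob : ∀ F ∈ 𝓕, ∀ c d, c < d → 0 < c → d < T → Ioo c d ⊆ D → F c ≤ F d := by
    intro F hF c d hcd hc hd hsub
    apply le_of_locally_monotone hcd ((hcont F hF).mono fun x hx => ⟨by linarith [hx.1],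
      by linarith [hx.2]⟩)
    intro τ hτ
    obtain ⟨δ, hδ, hm⟩ := hsub hτ
    exact ⟨δ, hδ, hm F hF⟩
  have hfm : ∀ σ, Measurable (f σ) := fun σ => h.measurable_deriv.comp measurable_prodMk_left
  have ham : ∀ σ, Measurable (a σ) := fun σ => h.measurable.comp measurable_prodMk_left
  have hfint : ∀ σ ∈ Ioo 0 T, Integrable (f σ) μ := fun σ hσ => by
    obtain ⟨N, hN⟩ := h.bounded σ hσ
    exact Integrable.of_bound (hfm σ).aestronglyMeasurable N (Filter.Eventually.of_forall hN)
  -- propagation of the monotonicity across a closed set on which `f` is bounded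
  have hprop : ∀ c d : ℝ, Ioo c d ⊆ Ioo 0 T → ∀ N : ℕ,
      (∀ τ ∈ Ioo c d, τ ∉ D → ∀ x, |f τ x| ≤ N) → ∀ F ∈ 𝓕, MonotoneOn F (Ioo c d) := by
    intro c d hcd N hN F hF r hr t ht hrt
    rcases hrt.eq_or_lt with rfl | hrt'
    · exact le_rfl
    have hr0 := hcd hr
    have ht0 := hcd ht
    have hIcc : Icc r t ⊆ Ioo 0 T := fun x hx => ⟨by linarith [hx.1, hr0.1], by linarith [hx.2, ht0.2]⟩
    obtain ⟨N₀, hN₀⟩ := h.bounded r hr0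
    set O := Ioo r t ∩ D
    have hO : IsOpen O := isOpen_Ioo.inter hDo
    have hsub : O ⊆ Ioo r t := inter_subset_left
    have hbad : ∀ τ ∈ Ioo r t \ O, ∀ x, |f τ x| ≤ N := fun τ hτ =>
      hN τ ⟨hr.1.trans hτ.1.1, hτ.1.2.trans ht.2⟩ fun hD => hτ.2 ⟨hτ.1, hD⟩
    have hmem : ∀ c : Gap O, c.1.1 ∈ Ioo 0 T ∧ c.1.2 ∈ Ioo 0 T := fun c => by
      have h1 := Gap.mem_Icc hsub c
      have h2 := c.2.1
      exact ⟨hIcc ⟨h1.1, by linarith⟩, hIcc ⟨by linarith, h1.2⟩⟩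
    have hgapmono : ∀ F ∈ 𝓕, ∀ c : Gap O, F c.1.1 ≤ F c.1.2 := fun F hF c =>
      hglob F hF _ _ c.2.1 (hmem c).1.1 (hmem c).2.2 (c.2.2.1.trans inter_subset_right)
    have hleft : ∀ c : Gap O, ∀ x, |f c.1.1 x| ≤ (max N N₀ : ℕ) := by
      intro c x
      rcases (Gap.mem_Icc hsub c).1.eq_or_lt with h1 | h1
      · rw [← h1]
        exact (hN₀ x).trans (by exact_mod_cast le_max_right _ _)
      · refine (hbad c.1.1 ⟨⟨h1, ?_⟩, c.2.2.2.1⟩ x).trans (by exact_mod_cast le_max_left _ _)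
        linarith [c.2.1, (Gap.mem_Icc hsub c).2]
    have hfcont : ∀ x, ContinuousOn (fun τ => f τ x) (Icc r t) := fun x =>
      (h.continuousOn x).mono hIcc
    have hFTC : ∀ x a' b', r ≤ a' → a' ≤ b' → b' ≤ t →
        ∫ τ in a'..b', f τ x = a b' x - a a' x := by
      intro x a' b' h1 h2 h3
      have hss : uIcc a' b' ⊆ Icc r t := by rw [uIcc_of_le h2]; exact Icc_subset_Icc h1 h3
      exact intervalIntegral.integral_eq_sub_of_hasDerivAt
        (fun τ hτ => h.hasDerivAt τ (hIcc (hss hτ)) x)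
        ((hfcont x).mono hss).intervalIntegrable
    have hint : ∀ x, IntegrableOn (fun τ => f τ x) (Ioo r t) := fun x =>
      ((hfcont x).integrableOn_Icc).mono_set Ioo_subset_Icc_self
    have hsum := summable_integral_abs_increment (μ := μ) (C := C (max N N₀)) hrt hO hsub hFTC hint
      h.measurable_deriv hbad (fun τ hτ => h.integrable τ (hIcc hτ)) (by
        intro c
        have := hgapmono _ (Or.inr ⟨max N N₀, c.1.1, (hmem c).1, hleft c, rfl⟩) c
        have h0 : H c.1.1 c.1.1 = 0 := by simp [hH]
        simp only [h0] at this
        simp only [hH] at this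
        linarith)
    rcases hF with rfl | ⟨M, s, hs, hM, rfl⟩
    · have := integral_increment_le (μ := μ) (y := fun τ x => -a τ x) (e := fun τ x => -f τ x)
        (C := -A) (N := N) hrt hO hsub (fun x a' b' h1 h2 h3 => by
          rw [intervalIntegral.integral_neg, hFTC x a' b' h1 h2 h3]; ring)
        (fun x => (hint x).neg) h.measurable_deriv.neg
        (fun τ hτ x => by rw [abs_neg]; exact hbad τ hτ x)
        (fun τ hτ => (h.integrable τ (hIcc hτ)).neg)
        (by
          convert hsum using 4 with c x
          rw [← abs_neg]; congr 1; ring)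
        (fun τ hτ => by
          rw [integral_neg]
          exact neg_le_neg (hA τ (hIcc (Ioo_subset_Icc_self hτ.1))))
        (fun c => by
          have := hgapmono Φ (Or.inl rfl) c
          simp only [hΦ] at this
          rw [integral_neg, integral_neg]
          linarith)
      simp only [integral_neg] at this
      simp only [hΦ]
      linarith
    · have hpi : ∀ τ ∈ Icc r t, Integrable (fun x => max (a s x - a τ x) 0) μ := fun τ hτ =>
        ((h.integrable s hs).sub (h.integrable τ (hIcc hτ))).pos_part
      have hmset : MeasurableSet {z : ℝ × X | 0 < a s z.2 - a z.1 z.2} :=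
        measurableSet_lt measurable_const (((ham s).comp measurable_snd).sub h.measurable)
      have hFTC' : ∀ x a' b', r ≤ a' → a' ≤ b' → b' ≤ t →
          ∫ τ in a'..b', (if 0 < a s x - a τ x then -f τ x else 0) =
            max (a s x - a b' x) 0 - max (a s x - a a' x) 0 := by
        intro x a' b' h1 h2 h3
        have hss : uIcc a' b' ⊆ Icc r t := by rw [uIcc_of_le h2]; exact Icc_subset_Icc h1 h3
        exact intervalIntegral_deriv_posPart
          (fun τ hτ => (h.hasDerivAt τ (hIcc (hss hτ)) x).const_sub _)
          ((hfcont x).mono hss).neg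
      have := integral_increment_le (μ := μ) (y := fun τ x => max (a s x - a τ x) 0)
        (e := fun τ x => if 0 < a s x - a τ x then -f τ x else 0)
        (C := C M) (N := N) hrt hO hsub hFTC'
        (fun x => by
          refine Integrable.mono (hint x) ?_ (Filter.Eventually.of_forall fun τ => ?_)
          · have : Measurable fun τ => if 0 < a s x - a τ x then -f τ x else 0 :=
              Measurable.ite (hmset.preimage (measurable_prodMk_right (y := x)))
                (h.measurable_deriv.comp measurable_prodMk_right).neg measurable_const
            exact this.aestronglyMeasurable
          · split_ifs <;> simp)
        (Measurable.ite hmset h.measurable_deriv.neg measurable_const)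
        (fun τ hτ x => by
          split_ifs
          · rw [abs_neg]; exact hbad τ hτ x
          · simp)
        hpi
        (by
          refine Summable.of_nonneg_of_le (fun c => integral_nonneg fun x => abs_nonneg _)
            (fun c => ?_) hsum
          have hc1 := hIcc.trans Subset.rfl
          have h1 := Gap.mem_Icc hsub c
          have h2 := c.2.1
          refine integral_mono ((hpi _ ⟨by linarith, h1.2⟩).sub (hpi _ ⟨h1.1, by linarith⟩)).abs
            ((h.integrable _ (hmem c).2).sub (h.integrable _ (hmem c).1)).abs fun x => ?_
          refine (abs_max_sub_max_le_abs _ _ _).trans (le_of_eq ?_)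
          rw [← abs_neg]; congr 1; ring)
        (fun τ hτ => hC M s hs hM τ (hIcc (Ioo_subset_Icc_self hτ.1)))
        (fun c => by
          have := hgapmono _ (Or.inr ⟨M, s, hs, hM, rfl⟩) c
          simp only [hH] at this
          linarith)
      simp only [hH]
      linarith
  have hall : Ioo 0 T ⊆ D := by
    by_contra hne
    set E := Ioo 0 T ∩ Dᶜ with hE
    have hEne : E.Nonempty := by
      obtain ⟨x, hx, hxD⟩ := not_subset.1 hne
      exact ⟨x, hx, hxD⟩
    have hloc : IsLocallyClosed E := isOpen_Ioo.isLocallyClosed.inter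
      hDo.isClosed_compl.isLocallyClosed
    have : LocallyCompactSpace E := hloc.locallyCompactSpace
    have : Nonempty E := hEne.to_subtype
    have hcl : ∀ N : ℕ, IsClosed {τ : E | ∀ x, |f τ x| ≤ N} := by
      intro N
      have : {τ : E | ∀ x, |f τ x| ≤ N} = ⋂ x, {τ : E | |f τ x| ≤ N} := by ext; simp
      rw [this]
      refine isClosed_iInter fun x => isClosed_le ?_ continuous_const
      have : Continuous fun τ : E => f τ x :=
        (h.continuousOn x).comp_continuous continuous_subtype_val fun τ => τ.2.1
      exact this.abs
    obtain ⟨N, τ₀, hτ₀⟩ := nonempty_interior_of_iUnion_of_closed hcl (by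
      ext τ
      simpa using h.bounded τ τ.2.1)
    rw [mem_interior_iff_mem_nhds, nhds_subtype_eq_comap, Filter.mem_comap] at hτ₀
    obtain ⟨W, hW, hWs⟩ := hτ₀
    obtain ⟨ε, hε, hεs⟩ := Metric.mem_nhds_iff.1 (Filter.inter_mem hW (isOpen_Ioo.mem_nhds τ₀.2.1))
    rw [Real.ball_eq_Ioo] at hεs
    refine τ₀.2.2 ⟨ε, hε, hprop _ _ (hεs.trans inter_subset_right) N fun τ hτ hτD => ?_⟩
    exact hWs (show (⟨τ, (hεs hτ).2, hτD⟩ : E) ∈ Subtype.val ⁻¹' W from (hεs hτ).1)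
  have := hglob Φ (Or.inl rfl) r t hrt hr.1 ht.2 fun x hx => hall ⟨hr.1.trans hx.1, hx.2.trans ht.2⟩
  simp only [hΦ] at this
  linarith

end SeparateEvolution
end

section IntegrationByParts

variable {E : Type*} [NormedAddCommGroup E] [NormedSpace ℝ E]

theorem contDiff_one_of_tsupport_subset {Ω : Set E} (hΩ : IsOpen Ω) {ζ : E → ℝ}
    (h : ContDiffOn ℝ 1 ζ Ω) (hs : tsupport ζ ⊆ Ω) : ContDiff ℝ 1 ζ :=
  contDiff_iff_contDiffAt.2 fun x => by
    by_cases hx : x ∈ tsupport ζ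
    · exact h.contDiffAt (hΩ.mem_nhds (hs hx))
    · exact contDiffAt_const.congr_of_eventuallyEq (notMem_tsupport_iff_eventuallyEq.1 hx)

omit [NormedSpace ℝ E] in
theorem continuous_of_tsupport_subset {Ω : Set E} (hΩ : IsOpen Ω) {g : E → ℝ}
    (h : ContinuousOn g Ω) (hs : tsupport g ⊆ Ω) : Continuous g :=
  continuous_of_tsupport fun _ hx => h.continuousAt (hΩ.mem_nhds (hs hx))

omit [NormedSpace ℝ E] in
theorem tsupport_subset_of_forall_zero {g ζ : E → ℝ} (h : ∀ x, x ∉ tsupport ζ → g x = 0) :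
    tsupport g ⊆ tsupport ζ :=
  closure_minimal (fun x hx => by_contra fun h' => hx (h x h')) (isClosed_tsupport ζ)

omit [NormedSpace ℝ E] in
theorem continuous_and_hasCompactSupport {Ω : Set E} (hΩ : IsOpen Ω) {g ζ : E → ℝ}
    (h : ContinuousOn g Ω) (hc : HasCompactSupport ζ) (hs : tsupport ζ ⊆ Ω)
    (h0 : ∀ x, x ∉ tsupport ζ → g x = 0) : Continuous g ∧ HasCompactSupport g :=
  ⟨continuous_of_tsupport_subset hΩ h ((tsupport_subset_of_forall_zero h0).trans hs),
    HasCompactSupport.of_support_subset_isCompact hc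
      fun x hx => by_contra fun h' => hx (h0 x h')⟩

omit [NormedSpace ℝ E] in
theorem integrable_of_zero_off_tsupport [MeasurableSpace E] [BorelSpace E]
    {μ : Measure E} [IsFiniteMeasureOnCompacts μ] {Ω : Set E} (hΩ : IsOpen Ω)
    {g ζ : E → ℝ} (h : ContinuousOn g Ω) (hc : HasCompactSupport ζ) (hs : tsupport ζ ⊆ Ω)
    (h0 : ∀ x, x ∉ tsupport ζ → g x = 0) : Integrable g μ :=
  let ⟨h1, h2⟩ := continuous_and_hasCompactSupport hΩ h hc hs h0
  h1.integrable_of_hasCompactSupport h2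

theorem fderiv_eq_zero_of_notMem_tsupport {ζ : E → ℝ} {x : E} (hx : x ∉ tsupport ζ) :
    fderiv ℝ ζ x = 0 :=
  by_contra fun h => hx (support_fderiv_subset ℝ h)

theorem integral_divergence_mul {n : ℕ} {Ω : Set (EuclideanSpace ℝ (Fin n))} (hΩ : IsOpen Ω)
    {P : EuclideanSpace ℝ (Fin n) → EuclideanSpace ℝ (Fin n)} (hP : ContDiffOn ℝ 1 P Ω)
    {ζ : EuclideanSpace ℝ (Fin n) → ℝ} (hζ : ContDiff ℝ 1 ζ) (hc : HasCompactSupport ζ)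
    (hs : tsupport ζ ⊆ Ω) :
    ∫ x, (∑ i, fderiv ℝ P x (EuclideanSpace.single i 1) i) * ζ x
      = -∫ x, fderiv ℝ ζ x (P x) := by
  have hPd : ∀ x ∈ Ω, DifferentiableAt ℝ P x := fun x hx =>
    (hP.contDiffAt (hΩ.mem_nhds hx)).differentiableAt one_ne_zero
  have hP' : ContinuousOn (fderiv ℝ P) Ω := hP.continuousOn_fderiv_of_isOpen hΩ le_rfl
  have hζ' : Continuous (fderiv ℝ ζ) := hζ.continuous_fderiv one_ne_zero
  have hcoord : ∀ i, ∀ x ∈ Ω, HasFDerivAt (fun y => P y i)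
      ((EuclideanSpace.proj i : EuclideanSpace ℝ (Fin n) →L[ℝ] ℝ).comp (fderiv ℝ P x)) x :=
    fun i x hx => (EuclideanSpace.proj i : EuclideanSpace ℝ (Fin n) →L[ℝ] ℝ).hasFDerivAt.comp x
      (hPd x hx).hasFDerivAt
  have hcc : ∀ i, ContinuousOn (fun y => P y i) Ω := fun i x hx =>
    (hcoord i x hx).continuousAt.continuousWithinAt
  have hi1 : ∀ i, Integrable (fun x => fderiv ℝ P x (EuclideanSpace.single i 1) i * ζ x) := by
    intro i
    refine integrable_of_zero_off_tsupport hΩ ?_ hc hs ?_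
    · exact (((EuclideanSpace.proj i : EuclideanSpace ℝ (Fin n) →L[ℝ] ℝ).continuous.comp_continuousOn
        (hP'.clm_apply continuousOn_const))).mul hζ.continuous.continuousOn
    · intro x hx; simp [image_eq_zero_of_notMem_tsupport hx]
  have hi2 : ∀ i, Integrable (fun x => P x i * fderiv ℝ ζ x (EuclideanSpace.single i 1)) := by
    intro i
    refine integrable_of_zero_off_tsupport hΩ ?_ hc hs ?_
    · exact (hcc i).mul (hζ'.clm_apply continuous_const).continuousOn
    · intro x hx; simp [fderiv_eq_zero_of_notMem_tsupport hx]
  have key : ∀ i, ∫ x, P x i * fderiv ℝ ζ x (EuclideanSpace.single i 1)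
      = -∫ x, fderiv ℝ P x (EuclideanSpace.single i 1) i * ζ x := by
    intro i
    have e : (fun x => fderiv ℝ P x (EuclideanSpace.single i 1) i * ζ x)
        = fun x => fderiv ℝ (fun y => P y i) x (EuclideanSpace.single i 1) * ζ x := by
      funext x
      by_cases hx : x ∈ Ω
      · rw [(hcoord i x hx).fderiv]; rfl
      · simp [image_eq_zero_of_notMem_tsupport fun h => hx (hs h)]
    rw [e]
    refine integral_mul_fderiv_eq_neg_fderiv_mul_of_integrable (e ▸ hi1 i) (hi2 i) ?_
      (fun x hx => (hcoord i x (hs hx)).differentiableAt)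
      (fun x _ => hζ.differentiable one_ne_zero x)
    refine integrable_of_zero_off_tsupport hΩ ?_ hc hs ?_
    · exact (hcc i).mul hζ.continuous.continuousOn
    · intro x hx; simp [image_eq_zero_of_notMem_tsupport hx]
  have e1 : ∀ x, fderiv ℝ ζ x (P x)
      = ∑ i, P x i * fderiv ℝ ζ x (EuclideanSpace.single i 1) := by
    intro x
    have hx : P x = ∑ i, P x i • (EuclideanSpace.single i (1 : ℝ)) := by
      ext j; simp [Finset.sum_apply, Pi.single_apply]
    conv_lhs => rw [hx]
    simp [map_sum]
  simp_rw [e1, Finset.sum_mul]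
  rw [integral_finsetSum _ fun i _ => hi1 i, integral_finsetSum _ fun i _ => hi2 i,
    ← Finset.sum_neg_distrib]
  exact Finset.sum_congr rfl fun i _ => by rw [key i, neg_neg]

end IntegrationByParts

section PowerField

open scoped InnerProductSpace

variable {E : Type*} [NormedAddCommGroup E] [InnerProductSpace ℝ E] {p : ℝ}

/-- The vector field `a ↦ ‖a‖^{p-2} a` underlying the `p`-Laplacian. -/
noncomputable def powField (p : ℝ) (a : E) : E := ‖a‖ ^ (p - 2) • a

omit [InnerProductSpace ℝ E] in
theorem norm_rpow_sub_two_mul (hp : 1 < p) (a : E) : ‖a‖ ^ (p - 2) * ‖a‖ = ‖a‖ ^ (p - 1) := by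
  rw [← Real.rpow_add_one' (norm_nonneg a) (by linarith)]
  congr 1; ring

theorem rpow_sub_one_mul_self (hp : 1 < p) {r : ℝ} (hr : 0 ≤ r) : r ^ (p - 1) * r = r ^ p := by
  rw [← Real.rpow_add_one' hr (by linarith)]
  congr 1; ring

theorem norm_powField (hp : 1 < p) (a : E) : ‖powField p a‖ = ‖a‖ ^ (p - 1) := by
  rw [powField, norm_smul, Real.norm_of_nonneg (by positivity), norm_rpow_sub_two_mul hp]

theorem inner_powField_self (hp : 1 < p) (a : E) : ⟪a, powField p a⟫_ℝ = ‖a‖ ^ p := by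
  rw [powField, real_inner_smul_right, real_inner_self_eq_norm_sq, pow_two, ← mul_assoc,
    norm_rpow_sub_two_mul hp, rpow_sub_one_mul_self hp (norm_nonneg a)]

theorem powField_monotone (hp : 1 < p) (a b : E) :
    0 ≤ ⟪a - b, powField p a - powField p b⟫_ℝ := by
  have h1 : ⟪a, powField p b⟫_ℝ ≤ ‖a‖ * ‖b‖ ^ (p - 1) := by
    rw [← norm_powField hp]; exact real_inner_le_norm _ _
  have h2 : ⟪b, powField p a⟫_ℝ ≤ ‖b‖ * ‖a‖ ^ (p - 1) := by
    rw [← norm_powField hp]; exact real_inner_le_norm _ _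
  have h3 : 0 ≤ (‖a‖ ^ (p - 1) - ‖b‖ ^ (p - 1)) * (‖a‖ - ‖b‖) := by
    rcases le_total ‖a‖ ‖b‖ with h | h
    · exact mul_nonneg_of_nonpos_of_nonpos
        (sub_nonpos.2 (Real.rpow_le_rpow (norm_nonneg _) h (by linarith))) (sub_nonpos.2 h)
    · exact mul_nonneg
        (sub_nonneg.2 (Real.rpow_le_rpow (norm_nonneg _) h (by linarith))) (sub_nonneg.2 h)
  have ha := rpow_sub_one_mul_self hp (norm_nonneg a)
  have hb := rpow_sub_one_mul_self hp (norm_nonneg b)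
  rw [inner_sub_left, inner_sub_right, inner_sub_right, inner_powField_self hp,
    inner_powField_self hp]
  nlinarith

theorem young_rpow (hp : 1 < p) {a b : ℝ} (ha : 0 ≤ a) (hb : 0 ≤ b) :
    p * a ^ (p - 1) * b ≤ (p - 1) * a ^ p + b ^ p := by
  have h := Real.young_inequality_of_nonneg hb (Real.rpow_nonneg ha (p - 1))
    (Real.HolderConjugate.conjExponent hp)
  have hp1 : p - 1 ≠ 0 := by linarith
  rw [← Real.rpow_mul ha, Real.conjExponent, mul_div_cancel₀ _ hp1] at h
  have e : p * (b ^ p / p + a ^ p / (p / (p - 1))) = (p - 1) * a ^ p + b ^ p := by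
    field_simp; ring
  calc p * a ^ (p - 1) * b = p * (b * a ^ (p - 1)) := by ring
    _ ≤ _ := by rw [← e]; gcongr

theorem exists_young_rpow_half (hp : 1 < p) : ∃ K : ℝ, 0 ≤ K ∧ ∀ a b : ℝ, 0 ≤ a → 0 ≤ b →
    p * a ^ (p - 1) * b ≤ (p - 1) / 2 * a ^ p + K * b ^ p := by
  set c : ℝ := (1 / 2 : ℝ) ^ p⁻¹ with hc
  have hc0 : 0 < c := by positivity
  refine ⟨(c ^ (1 - p)) ^ p, by positivity, fun a b ha hb => ?_⟩
  have h := young_rpow hp (mul_nonneg hc0.le ha) (mul_nonneg (Real.rpow_nonneg hc0.le (1 - p)) hb)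
  rw [Real.mul_rpow hc0.le ha, Real.mul_rpow hc0.le ha, Real.mul_rpow (by positivity) hb] at h
  have e1 : c ^ (p - 1) * c ^ (1 - p) = 1 := by
    rw [← Real.rpow_add hc0]; simp
  have e2 : c ^ p = 1 / 2 := by
    rw [hc, ← Real.rpow_mul (by norm_num), inv_mul_cancel₀ (by linarith), Real.rpow_one]
  rw [e2] at h
  calc p * a ^ (p - 1) * b = p * (c ^ (p - 1) * a ^ (p - 1)) * (c ^ (1 - p) * b) := by
        linear_combination (-(p * a ^ (p - 1) * b)) * e1
    _ ≤ _ := h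
    _ = _ := by ring

end PowerField

section LogarithmicTest

open scoped InnerProductSpace

variable {n : ℕ} {p : ℝ} {Ω : Set (EuclideanSpace ℝ (Fin n))}
  {U W : EuclideanSpace ℝ (Fin n) → ℝ}

/-- Positive functions on `Ω` regular enough for the `p`-Laplacian to be classical. -/
structure ClassicalPositive (p : ℝ) (Ω : Set (EuclideanSpace ℝ (Fin n)))
    (U : EuclideanSpace ℝ (Fin n) → ℝ) : Prop where
  pos : ∀ x ∈ Ω, 0 < U x
  contDiffOn : ContDiffOn ℝ 2 U Ω
  contDiffOn_pVF : ContDiffOn ℝ 1 (pVF p U) Ω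

/-- The logarithmic gradient `∇U / U`. -/
noncomputable def logGrad (U : EuclideanSpace ℝ (Fin n) → ℝ)
    (x : EuclideanSpace ℝ (Fin n)) : EuclideanSpace ℝ (Fin n) := (U x)⁻¹ • gradient U x

theorem fderiv_eq_inner_gradient (U : EuclideanSpace ℝ (Fin n) → ℝ)
    (x v : EuclideanSpace ℝ (Fin n)) : fderiv ℝ U x v = ⟪gradient U x, v⟫_ℝ := by
  rw [← toDual_gradient]; rfl

theorem norm_gradient_eq (U : EuclideanSpace ℝ (Fin n) → ℝ) (x : EuclideanSpace ℝ (Fin n)) :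
    ‖gradient U x‖ = ‖fderiv ℝ U x‖ := by
  rw [← toDual_gradient, LinearIsometryEquiv.norm_map]

theorem pVF_eq_rpow_smul {x : EuclideanSpace ℝ (Fin n)} (hU : 0 < U x) :
    pVF p U x = U x ^ (p - 1) • powField p (logGrad U x) := by
  have e : ‖logGrad U x‖ = (U x)⁻¹ * ‖gradient U x‖ := by
    rw [logGrad, norm_smul, Real.norm_of_nonneg (by positivity)]
  rw [powField, e, logGrad, pVF, Real.mul_rpow (by positivity) (norm_nonneg _), smul_smul, smul_smul]
  congr 1
  rw [Real.inv_rpow hU.le, ← Real.rpow_neg hU.le]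
  have h : U x ^ (p - 1) * U x ^ (-(p - 2)) * (U x)⁻¹ = 1 := by
    rw [← Real.rpow_neg_one (U x), ← Real.rpow_add hU, ← Real.rpow_add hU]
    rw [show p - 1 + -(p - 2) + -1 = 0 by ring, Real.rpow_zero]
  linear_combination (-‖gradient U x‖ ^ (p - 2)) * h

theorem powField_logGrad_eq {x : EuclideanSpace ℝ (Fin n)} (hU : 0 < U x) :
    powField p (logGrad U x) = U x ^ (1 - p) • pVF p U x := by
  rw [pVF_eq_rpow_smul hU, smul_smul, ← Real.rpow_add hU]
  simp

namespace ClassicalPositive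

theorem differentiableAt (hΩ : IsOpen Ω) (hU : ClassicalPositive p Ω U) {x} (hx : x ∈ Ω) :
    DifferentiableAt ℝ U x :=
  (hU.contDiffOn.contDiffAt (hΩ.mem_nhds hx)).differentiableAt two_ne_zero

theorem continuousOn_gradient (hΩ : IsOpen Ω) (hU : ClassicalPositive p Ω U) :
    ContinuousOn (gradient U) Ω :=
  (InnerProductSpace.toDual ℝ (EuclideanSpace ℝ (Fin n))).symm.continuous.comp_continuousOn
    (hU.contDiffOn.continuousOn_fderiv_of_isOpen hΩ one_le_two)

theorem continuousOn_logGrad (hΩ : IsOpen Ω) (hU : ClassicalPositive p Ω U) :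
    ContinuousOn (logGrad U) Ω :=
  (hU.contDiffOn.continuousOn.inv₀ fun x hx => (hU.pos x hx).ne').smul
    (hU.continuousOn_gradient hΩ)

theorem continuousOn_rpow (hU : ClassicalPositive p Ω U) (q : ℝ) :
    ContinuousOn (fun x => U x ^ q) Ω :=
  hU.contDiffOn.continuousOn.rpow_const fun x hx => Or.inl (hU.pos x hx).ne'

theorem continuousOn_powField (hU : ClassicalPositive p Ω U) :
    ContinuousOn (fun x => powField p (logGrad U x)) Ω :=
  ((hU.continuousOn_rpow (1 - p)).smul hU.contDiffOn_pVF.continuousOn).congr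
    fun x hx => powField_logGrad_eq (hU.pos x hx)

theorem continuousOn_pLaplacian (hΩ : IsOpen Ω) (hU : ClassicalPositive p Ω U) :
    ContinuousOn (pLaplacian p U) Ω := by
  refine continuousOn_finsetSum _ fun i _ => ?_
  exact (EuclideanSpace.proj i : EuclideanSpace ℝ (Fin n) →L[ℝ] ℝ).continuous.comp_continuousOn
    ((hU.contDiffOn_pVF.continuousOn_fderiv_of_isOpen hΩ le_rfl).clm_apply continuousOn_const)

theorem hasFDerivAt_log (hΩ : IsOpen Ω) (hU : ClassicalPositive p Ω U) {x} (hx : x ∈ Ω) :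
    HasFDerivAt (fun y => Real.log (U y)) (innerSL ℝ (logGrad U x)) x := by
  refine ((hU.differentiableAt hΩ hx).hasFDerivAt.log (hU.pos x hx).ne').congr_fderiv ?_
  refine ContinuousLinearMap.ext fun v => ?_
  simp [logGrad]

theorem contDiffOn_log (hU : ClassicalPositive p Ω U) :
    ContDiffOn ℝ 1 (fun y => Real.log (U y)) Ω :=
  (hU.contDiffOn.of_le one_le_two).log fun x hx => (hU.pos x hx).ne'

theorem integral_mul_pLaplacian (hΩ : IsOpen Ω) (hp : 1 < p) (hU : ClassicalPositive p Ω U)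
    {ζ : EuclideanSpace ℝ (Fin n) → ℝ} (hζ : ContDiff ℝ 1 ζ) (hc : HasCompactSupport ζ)
    (hs : tsupport ζ ⊆ Ω) :
    ∫ x, U x ^ (1 - p) * pLaplacian p U x * ζ x
      = ∫ x, ((p - 1) * ‖logGrad U x‖ ^ p * ζ x - fderiv ℝ ζ x (powField p (logGrad U x))) := by
  set ξ : EuclideanSpace ℝ (Fin n) → ℝ := fun x => U x ^ (1 - p) * ζ x with hξ
  have hts : tsupport ξ ⊆ tsupport ζ := tsupport_mul_subset_right
  have hξ1 : ContDiff ℝ 1 ξ := contDiff_one_of_tsupport_subset hΩ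
    (((hU.contDiffOn.of_le one_le_two).rpow_const_of_ne fun x hx => (hU.pos x hx).ne').mul
      hζ.contDiffOn) (hts.trans hs)
  have h := integral_divergence_mul hΩ hU.contDiffOn_pVF hξ1
    (hc.mul_left (f := fun x => U x ^ (1 - p))) (hts.trans hs)
  calc ∫ x, U x ^ (1 - p) * pLaplacian p U x * ζ x
      = ∫ x, (∑ i, fderiv ℝ (pVF p U) x (EuclideanSpace.single i 1) i) * ξ x := by
        refine integral_congr_ae (.of_forall fun x => ?_)
        simp only [pLaplacian, hξ]; ring
    _ = _ := h
    _ = _ := by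
        rw [← integral_neg]
        refine integral_congr_ae (.of_forall fun x => ?_)
        by_cases hx : x ∈ Ω
        · have hx0 := hU.pos x hx
          have h1 := ((hU.differentiableAt hΩ hx).hasFDerivAt.rpow_const (p := 1 - p)
            (Or.inl hx0.ne')).mul (hζ.differentiable one_ne_zero x).hasFDerivAt
          have h2 : ⟪gradient U x, powField p (logGrad U x)⟫_ℝ = U x * ‖logGrad U x‖ ^ p := by
            rw [← inner_powField_self hp, ← real_inner_smul_left, logGrad, smul_smul,
              mul_inv_cancel₀ hx0.ne', one_smul]
          have e1 : U x ^ (1 - p) * U x ^ (p - 1) = 1 := by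
            rw [← Real.rpow_add hx0]; simp
          have e2 : U x ^ (1 - p - 1) * U x ^ (p - 1) * U x = 1 := by
            rw [← Real.rpow_add hx0, ← Real.rpow_add_one hx0.ne',
              show 1 - p - 1 + (p - 1) + 1 = 0 by ring, Real.rpow_zero]
          simp only
          rw [show fderiv ℝ ξ x = _ from h1.fderiv, pVF_eq_rpow_smul hx0]
          simp only [_root_.add_apply, _root_.smul_apply, map_smul,
            smul_eq_mul, fderiv_eq_inner_gradient U, h2]
          linear_combination (-fderiv ℝ ζ x (powField p (logGrad U x))) * e1
            + ((p - 1) * ‖logGrad U x‖ ^ p * ζ x) * e2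
        · have hx' : x ∉ tsupport ζ := fun h => hx (hs h)
          simp [fderiv_eq_zero_of_notMem_tsupport hx', image_eq_zero_of_notMem_tsupport hx',
            fderiv_eq_zero_of_notMem_tsupport fun h => hx' (hts h)]

end ClassicalPositive

end LogarithmicTest

section EnergyEstimates

open scoped InnerProductSpace

variable {n : ℕ} {p : ℝ} {Ω : Set (EuclideanSpace ℝ (Fin n))}
  {U W V φ : EuclideanSpace ℝ (Fin n) → ℝ}

theorem contDiff_abs_rpow (hp : 1 < p) (hφ : ContDiff ℝ 1 φ) :
    ContDiff ℝ 1 fun x => |φ x| ^ p := hφ.norm_rpow hp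

theorem tsupport_abs_rpow_subset (hp : 1 < p) : tsupport (fun x => |φ x| ^ p) ⊆ tsupport φ := by
  refine closure_mono fun x hx h0 => hx ?_
  simp [show φ x = 0 from h0, Real.zero_rpow (by linarith : p ≠ 0)]

theorem hasCompactSupport_abs_rpow (hp : 1 < p) (hc : HasCompactSupport φ) :
    HasCompactSupport fun x => |φ x| ^ p :=
  hc.of_isClosed_subset (isClosed_tsupport _) (tsupport_abs_rpow_subset hp)

theorem continuous_norm_gradient_rpow (hp : 1 < p) (hφ : ContDiff ℝ 1 φ) :
    Continuous fun x => ‖gradient φ x‖ ^ p := by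
  simp_rw [norm_gradient_eq]
  exact (hφ.continuous_fderiv one_ne_zero).norm.rpow_const fun _ => Or.inr (by linarith)

theorem integrable_norm_gradient_rpow (hp : 1 < p) (hφ : ContDiff ℝ 1 φ)
    (hc : HasCompactSupport φ) : Integrable fun x => ‖gradient φ x‖ ^ p := by
  refine integrable_of_zero_off_tsupport isOpen_univ
    (continuous_norm_gradient_rpow hp hφ).continuousOn hc (subset_univ _) fun x hx => ?_
  simp [norm_gradient_eq, fderiv_eq_zero_of_notMem_tsupport hx,
    Real.zero_rpow (by linarith : p ≠ 0)]

theorem abs_fderiv_abs_rpow_le (hp : 1 < p) (hφ : ContDiff ℝ 1 φ)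
    (x a : EuclideanSpace ℝ (Fin n)) :
    |fderiv ℝ (fun x => |φ x| ^ p) x (powField p a)|
      ≤ p * (‖a‖ * |φ x|) ^ (p - 1) * ‖gradient φ x‖ := by
  have h1 := norm_fderiv_norm_rpow_le (hφ.differentiable one_ne_zero) (x := x) hp
  have h2 := (fderiv ℝ (fun x => ‖φ x‖ ^ p) x).le_opNorm (powField p a)
  rw [norm_powField hp] at h2
  refine h2.trans ?_
  rw [norm_gradient_eq, Real.mul_rpow (norm_nonneg _) (abs_nonneg _)]
  calc _ ≤ p * ‖φ x‖ ^ (p - 1) * ‖fderiv ℝ φ x‖ * ‖a‖ ^ (p - 1) := by gcongr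
    _ = _ := by rw [Real.norm_eq_abs]; ring

theorem abs_fderiv_abs_rpow_le_young (hp : 1 < p) (hφ : ContDiff ℝ 1 φ)
    (x a : EuclideanSpace ℝ (Fin n)) :
    |fderiv ℝ (fun x => |φ x| ^ p) x (powField p a)|
      ≤ (p - 1) * ‖a‖ ^ p * |φ x| ^ p + ‖gradient φ x‖ ^ p := by
  refine (abs_fderiv_abs_rpow_le hp hφ x a).trans
    ((young_rpow hp (by positivity) (norm_nonneg _)).trans_eq ?_)
  rw [Real.mul_rpow (norm_nonneg _) (abs_nonneg _), mul_assoc]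

/-- The time derivative of `U^{2-p} ψ / (2-p)` along `∂ₜU = Δ_p U + V U^{p-1}`. -/
noncomputable def evolutionRate (p : ℝ) (V ψ U : EuclideanSpace ℝ (Fin n) → ℝ)
    (x : EuclideanSpace ℝ (Fin n)) : ℝ := (U x ^ (1 - p) * pLaplacian p U x + V x) * ψ x

theorem evolutionRate_eq_zero {ψ : EuclideanSpace ℝ (Fin n) → ℝ} {x} (h : ψ x = 0) :
    evolutionRate p V ψ U x = 0 := by simp [evolutionRate, h]

theorem integrable_potential (hΩ : IsOpen Ω) (hV : ContinuousOn V Ω)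
    {ζ : EuclideanSpace ℝ (Fin n) → ℝ} (hζ : Continuous ζ) (hc : HasCompactSupport ζ)
    (hs : tsupport ζ ⊆ Ω) : Integrable fun x => V x * ζ x :=
  integrable_of_zero_off_tsupport hΩ (hV.mul hζ.continuousOn) hc hs fun x hx => by
    simp [image_eq_zero_of_notMem_tsupport hx]

namespace ClassicalPositive

section Integrability

variable {ζ : EuclideanSpace ℝ (Fin n) → ℝ}

theorem integrable_pLaplacian (hΩ : IsOpen Ω) (hU : ClassicalPositive p Ω U)
    (hζ : Continuous ζ) (hc : HasCompactSupport ζ) (hs : tsupport ζ ⊆ Ω) :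
    Integrable fun x => U x ^ (1 - p) * pLaplacian p U x * ζ x :=
  integrable_of_zero_off_tsupport hΩ
    (((hU.continuousOn_rpow _).mul (hU.continuousOn_pLaplacian hΩ)).mul hζ.continuousOn) hc hs
    fun x hx => by simp [image_eq_zero_of_notMem_tsupport hx]

theorem integrable_logGrad (hΩ : IsOpen Ω) (hp : 1 < p) (hU : ClassicalPositive p Ω U)
    (hζ : Continuous ζ) (hc : HasCompactSupport ζ) (hs : tsupport ζ ⊆ Ω) :
    Integrable fun x => (p - 1) * ‖logGrad U x‖ ^ p * ζ x :=
  integrable_of_zero_off_tsupport hΩ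
    ((continuousOn_const.mul ((hU.continuousOn_logGrad hΩ).norm.rpow_const fun _ _ =>
      Or.inr (by linarith))).mul hζ.continuousOn) hc hs
    fun x hx => by simp [image_eq_zero_of_notMem_tsupport hx]

theorem integrable_fderiv_powField (hΩ : IsOpen Ω) (hU : ClassicalPositive p Ω U)
    (hζ : ContDiff ℝ 1 ζ) (hc : HasCompactSupport ζ) (hs : tsupport ζ ⊆ Ω) :
    Integrable fun x => fderiv ℝ ζ x (powField p (logGrad U x)) :=
  integrable_of_zero_off_tsupport hΩ
    ((hζ.continuous_fderiv one_ne_zero).continuousOn.clm_apply hU.continuousOn_powField) hc hs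
    fun x hx => by simp [fderiv_eq_zero_of_notMem_tsupport hx]

theorem integrable_weak_pLaplacian (hΩ : IsOpen Ω) (hp : 1 < p) (hU : ClassicalPositive p Ω U)
    (hζ : ContDiff ℝ 1 ζ) (hc : HasCompactSupport ζ) (hs : tsupport ζ ⊆ Ω) :
    Integrable fun x => (p - 1) * ‖logGrad U x‖ ^ p * ζ x
      - fderiv ℝ ζ x (powField p (logGrad U x)) :=
  (hU.integrable_logGrad hΩ hp hζ.continuous hc hs).sub
    (hU.integrable_fderiv_powField hΩ hζ hc hs)

theorem continuous_evolutionRate (hΩ : IsOpen Ω) (hU : ClassicalPositive p Ω U)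
    (hV : ContinuousOn V Ω) (hζ : Continuous ζ) (hc : HasCompactSupport ζ)
    (hs : tsupport ζ ⊆ Ω) :
    Continuous (evolutionRate p V ζ U) ∧ HasCompactSupport (evolutionRate p V ζ U) :=
  continuous_and_hasCompactSupport hΩ
    ((((hU.continuousOn_rpow _).mul (hU.continuousOn_pLaplacian hΩ)).add hV).mul hζ.continuousOn)
    hc hs fun _ hx => evolutionRate_eq_zero (image_eq_zero_of_notMem_tsupport hx)

theorem integrable_evolutionRate (hΩ : IsOpen Ω) (hU : ClassicalPositive p Ω U)
    (hV : ContinuousOn V Ω) (hζ : Continuous ζ) (hc : HasCompactSupport ζ)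
    (hs : tsupport ζ ⊆ Ω) : Integrable (evolutionRate p V ζ U) :=
  let ⟨h1, h2⟩ := hU.continuous_evolutionRate hΩ hV hζ hc hs
  h1.integrable_of_hasCompactSupport h2

theorem integral_evolutionRate (hΩ : IsOpen Ω) (hp : 1 < p) (hU : ClassicalPositive p Ω U)
    (hV : ContinuousOn V Ω) (hζ : ContDiff ℝ 1 ζ) (hc : HasCompactSupport ζ)
    (hs : tsupport ζ ⊆ Ω) :
    ∫ x, evolutionRate p V ζ U x = ∫ x, ((p - 1) * ‖logGrad U x‖ ^ p * ζ x
      - fderiv ℝ ζ x (powField p (logGrad U x)) + V x * ζ x) := by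
  rw [integral_add (hU.integrable_weak_pLaplacian hΩ hp hζ hc hs)
      (integrable_potential hΩ hV hζ.continuous hc hs),
    ← hU.integral_mul_pLaplacian hΩ hp hζ hc hs,
    ← integral_add (hU.integrable_pLaplacian hΩ hζ.continuous hc hs)
      (integrable_potential hΩ hV hζ.continuous hc hs)]
  refine integral_congr_ae (.of_forall fun x => ?_)
  simp only [evolutionRate]; ring

end Integrability

theorem le_integral_evolutionRate (hΩ : IsOpen Ω) (hp : 1 < p) (hU : ClassicalPositive p Ω U)
    (hV : ContinuousOn V Ω) (hφ : ContDiff ℝ 1 φ) (hc : HasCompactSupport φ)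
    (hs : tsupport φ ⊆ Ω) :
    (∫ x, V x * |φ x| ^ p) - ∫ x, ‖gradient φ x‖ ^ p
      ≤ ∫ x, evolutionRate p V (fun x => |φ x| ^ p) U x := by
  have hψ := contDiff_abs_rpow hp hφ
  have hψc := hasCompactSupport_abs_rpow hp hc
  have hψs := (tsupport_abs_rpow_subset hp).trans hs
  have hVi := integrable_potential hΩ hV hψ.continuous hψc hψs
  have hDi := integrable_norm_gradient_rpow hp hφ hc
  rw [hU.integral_evolutionRate hΩ hp hV hψ hψc hψs, ← integral_sub hVi hDi]
  refine integral_mono (hVi.sub hDi) ((hU.integrable_weak_pLaplacian hΩ hp hψ hψc hψs).add hVi) fun x => ?_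
  have := (le_abs_self _).trans (abs_fderiv_abs_rpow_le_young hp hφ x (logGrad U x))
  simp only
  linarith

theorem integral_le_of_support_subset {g : EuclideanSpace ℝ (Fin n) → ℝ}
    (hΩf : volume Ω ≠ ⊤) (hg : Integrable g) (h0 : ∀ x ∉ Ω, g x = 0) {N : ℝ}
    (hN : ∀ x, g x ≤ N) : ∫ x, g x ≤ N * volume.real Ω := by
  rw [← setIntegral_eq_integral_of_forall_compl_eq_zero h0]
  have : IsFiniteMeasure (volume.restrict Ω) := ⟨by simpa using hΩf.lt_top⟩
  refine (integral_mono hg.integrableOn (integrable_const N) hN).trans_eq ?_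
  simp [mul_comm]

theorem integral_logGrad_le (hΩ : IsOpen Ω) (hΩf : volume Ω ≠ ⊤) (hp : 1 < p)
    (hU : ClassicalPositive p Ω U) (hV : ContinuousOn V Ω) (hφ : ContDiff ℝ 1 φ)
    (hc : HasCompactSupport φ) (hs : tsupport φ ⊆ Ω) {K N : ℝ}
    (hK : ∀ a b : ℝ, 0 ≤ a → 0 ≤ b → p * a ^ (p - 1) * b ≤ (p - 1) / 2 * a ^ p + K * b ^ p)
    (hN : ∀ x, |evolutionRate p V (fun x => |φ x| ^ p) U x| ≤ N) :
    ∫ x, (p - 1) * ‖logGrad U x‖ ^ p * |φ x| ^ p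
      ≤ 2 * (N * volume.real Ω - (∫ x, V x * |φ x| ^ p) + K * ∫ x, ‖gradient φ x‖ ^ p) := by
  have hψ := contDiff_abs_rpow hp hφ
  have hψc := hasCompactSupport_abs_rpow hp hc
  have hψs := (tsupport_abs_rpow_subset hp).trans hs
  have hVi := integrable_potential hΩ hV hψ.continuous hψc hψs
  have hDi := integrable_norm_gradient_rpow hp hφ hc
  have hLi := hU.integrable_logGrad hΩ hp hψ.continuous hψc hψs
  have h1 := hU.integral_evolutionRate hΩ hp hV hψ hψc hψs
  have h2 : ∫ x, evolutionRate p V (fun x => |φ x| ^ p) U x ≤ N * volume.real Ω :=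
    integral_le_of_support_subset hΩf
      (hU.integrable_evolutionRate hΩ hV hψ.continuous hψc hψs)
      (fun x hx => evolutionRate_eq_zero
        (image_eq_zero_of_notMem_tsupport (f := fun x => |φ x| ^ p) fun h => hx (hψs h)))
      fun x => (le_abs_self _).trans (hN x)
  have hB : Integrable fun x => (p - 1) * ‖logGrad U x‖ ^ p * |φ x| ^ p * (1 / 2)
      - K * ‖gradient φ x‖ ^ p := (hLi.mul_const _).sub (hDi.const_mul K)
  have h3 : (∫ x, ((p - 1) * ‖logGrad U x‖ ^ p * |φ x| ^ p * (1 / 2) - K * ‖gradient φ x‖ ^ p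
      + V x * |φ x| ^ p)) ≤ ∫ x, ((p - 1) * ‖logGrad U x‖ ^ p * |φ x| ^ p
      - fderiv ℝ (fun x => |φ x| ^ p) x (powField p (logGrad U x)) + V x * |φ x| ^ p) := by
    refine integral_mono (hB.add hVi)
      ((hU.integrable_weak_pLaplacian hΩ hp hψ hψc hψs).add hVi) fun x => ?_
    have e := (abs_fderiv_abs_rpow_le hp hφ x (logGrad U x)).trans
      (hK _ _ (by positivity) (norm_nonneg _))
    rw [Real.mul_rpow (norm_nonneg _) (abs_nonneg _)] at e
    have := (le_abs_self _).trans e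
    simp only
    linarith
  rw [integral_add hB hVi,
    integral_sub (hLi.mul_const _) (hDi.const_mul K), integral_mul_const, integral_const_mul] at h3
  linarith

theorem neg_integral_evolutionRate_mul_le (hΩ : IsOpen Ω) (hΩf : volume Ω ≠ ⊤) (hp : 1 < p)
    (hU : ClassicalPositive p Ω U) (hW : ClassicalPositive p Ω W) (hV : ContinuousOn V Ω)
    (hφ : ContDiff ℝ 1 φ) (hc : HasCompactSupport φ) (hs : tsupport φ ⊆ Ω) {N : ℝ}
    (hN : ∀ x, |evolutionRate p V (fun x => |φ x| ^ p) W x| ≤ N)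
    {g : ℝ → ℝ} (hg : ContDiff ℝ 1 g) (hgm : Monotone g) (hg0 : ∀ r, 0 ≤ g r)
    (hg1 : ∀ r, g r ≤ 1) :
    ∫ x, -evolutionRate p V (fun x => |φ x| ^ p) U x * g (Real.log (W x) - Real.log (U x))
      ≤ N * volume.real Ω + 2 * (∫ x, (p - 1) * ‖logGrad W x‖ ^ p * |φ x| ^ p)
        + 2 * ∫ x, ‖gradient φ x‖ ^ p := by
  have hψ := contDiff_abs_rpow hp hφ
  have hψc := hasCompactSupport_abs_rpow hp hc
  have hψs := (tsupport_abs_rpow_subset hp).trans hs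
  have hDi := integrable_norm_gradient_rpow hp hφ hc
  have hLi := hW.integrable_logGrad hΩ hp hψ.continuous hψc hψs
  set ψ : EuclideanSpace ℝ (Fin n) → ℝ := fun x => |φ x| ^ p with hψd
  have hψ0 : ∀ x, 0 ≤ ψ x := fun x => by positivity
  set η : EuclideanSpace ℝ (Fin n) → ℝ := fun x => g (Real.log (W x) - Real.log (U x)) with hη
  set ζ : EuclideanSpace ℝ (Fin n) → ℝ := fun x => η x * ψ x with hζd
  have hts : tsupport ζ ⊆ tsupport ψ := tsupport_mul_subset_right
  have hζs := hts.trans hψs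
  have hζc : HasCompactSupport ζ := hψc.mul_left
  have hζ : ContDiff ℝ 1 ζ := contDiff_one_of_tsupport_subset hΩ
    ((hg.comp_contDiffOn (hW.contDiffOn_log.sub hU.contDiffOn_log)).mul hψ.contDiffOn) hζs
  have hRW := hW.integrable_evolutionRate hΩ hV hζ.continuous hζc hζs
  have hIW := hW.integrable_weak_pLaplacian hΩ hp hζ hζc hζs
  have hIU := hU.integrable_weak_pLaplacian hΩ hp hζ hζc hζs
  have hVi := integrable_potential hΩ hV hζ.continuous hζc hζs
  have hre : ∀ Z x, evolutionRate p V ζ Z x = evolutionRate p V ψ Z x * η x := fun Z x => by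
    simp only [evolutionRate, hζd]; ring
  have h1 : -∫ x, evolutionRate p V ζ W x ≤ N * volume.real Ω := by
    rw [← integral_neg]
    refine integral_le_of_support_subset hΩf hRW.neg (fun x hx => ?_) fun x => ?_
    · rw [Pi.neg_apply,
        evolutionRate_eq_zero (image_eq_zero_of_notMem_tsupport fun h => hx (hζs h)), neg_zero]
    · rw [Pi.neg_apply, hre]
      have := hN x
      calc _ ≤ |evolutionRate p V ψ W x * η x| := neg_le_abs _
        _ = |evolutionRate p V ψ W x| * η x := by rw [abs_mul, abs_of_nonneg (hg0 _)]
        _ ≤ |evolutionRate p V ψ W x| * 1 := by gcongr; exact hg1 _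
        _ ≤ N := by rwa [mul_one]
  have hpt : ∀ x, ((p - 1) * ‖logGrad W x‖ ^ p * ζ x
        - fderiv ℝ ζ x (powField p (logGrad W x))) - ((p - 1) * ‖logGrad U x‖ ^ p * ζ x
        - fderiv ℝ ζ x (powField p (logGrad U x)))
      ≤ 2 * ((p - 1) * ‖logGrad W x‖ ^ p * ψ x) + 2 * ‖gradient φ x‖ ^ p := by
    intro x
    have hr1 : 0 ≤ (p - 1) * ‖logGrad W x‖ ^ p * ψ x :=
      mul_nonneg (mul_nonneg (by linarith) (by positivity)) (hψ0 x)
    have hr2 : 0 ≤ ‖gradient φ x‖ ^ p := by positivity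
    by_cases hx : x ∈ Ω
    · have hη' : HasFDerivAt η (deriv g (Real.log (W x) - Real.log (U x)) •
          (innerSL ℝ (logGrad W x) - innerSL ℝ (logGrad U x))) x :=
        ((hg.differentiable one_ne_zero _).hasDerivAt).comp_hasFDerivAt x
          ((hW.hasFDerivAt_log hΩ hx).sub (hU.hasFDerivAt_log hΩ hx))
      have hζ' : fderiv ℝ ζ x = _ :=
        (hη'.mul (hψ.differentiable one_ne_zero x).hasFDerivAt).fderiv
      have hd := hgm.deriv_nonneg (x := Real.log (W x) - Real.log (U x))
      have hm := mul_nonneg (mul_nonneg hd (hψ0 x)) (powField_monotone hp (logGrad W x) (logGrad U x))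
      have hyW := abs_le.1 (abs_fderiv_abs_rpow_le_young hp hφ x (logGrad W x))
      have hyU := abs_le.1 (abs_fderiv_abs_rpow_le_young hp hφ x (logGrad U x))
      rw [hζ']
      simp only [_root_.add_apply, _root_.smul_apply, _root_.sub_apply, innerSL_apply_apply,
        smul_eq_mul, hζd]
      rw [inner_sub_right, inner_sub_left, inner_sub_left] at hm
      have e1 := mul_le_mul_of_nonneg_left (show (p - 1) * ‖logGrad W x‖ ^ p * ψ x
        - fderiv ℝ ψ x (powField p (logGrad W x)) - (p - 1) * ‖logGrad U x‖ ^ p * ψ x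
        + fderiv ℝ ψ x (powField p (logGrad U x))
          ≤ 2 * ((p - 1) * ‖logGrad W x‖ ^ p * ψ x) + 2 * ‖gradient φ x‖ ^ p by
          linarith [hyW.1, hyU.2]) (hg0 (Real.log (W x) - Real.log (U x)))
      have e2 := mul_le_mul_of_nonneg_right (hg1 (Real.log (W x) - Real.log (U x)))
        (show 0 ≤ 2 * ((p - 1) * ‖logGrad W x‖ ^ p * ψ x) + 2 * ‖gradient φ x‖ ^ p by linarith)
      have e := e1.trans e2
      simp only [hη] at e ⊢
      nlinarith
    · have hx' : x ∉ tsupport ζ := fun h => hx (hζs h)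
      rw [fderiv_eq_zero_of_notMem_tsupport hx', image_eq_zero_of_notMem_tsupport hx']
      simp only [mul_zero, _root_.zero_apply, sub_zero]
      linarith
  have h2 := integral_mono (hIW.sub hIU) ((hLi.const_mul 2).add (hDi.const_mul 2)) hpt
  simp only [Pi.sub_apply, Pi.add_apply] at h2
  have h3 := hW.integral_evolutionRate hΩ hp hV hζ hζc hζs
  have h4 := hU.integral_evolutionRate hΩ hp hV hζ hζc hζs
  have a3 := integral_add hIW hVi
  have a4 := integral_add hIU hVi
  have a2 := integral_sub hIW hIU
  have a5 := integral_add (hLi.const_mul 2) (hDi.const_mul 2)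
  rw [integral_const_mul, integral_const_mul] at a5
  have h5 : ∫ x, -evolutionRate p V ψ U x * η x = -∫ x, evolutionRate p V ζ U x := by
    rw [← integral_neg]
    exact integral_congr_ae (.of_forall fun x => by simp only [hre]; ring)
  rw [h5]
  linarith

end ClassicalPositive

end EnergyEstimates

section EnergyLimit

open Filter Topology

variable {n : ℕ} {p : ℝ} {Ω : Set (EuclideanSpace ℝ (Fin n))}
  {U W V φ : EuclideanSpace ℝ (Fin n) → ℝ}

theorem tendsto_smoothTransition_nat_mul (r : ℝ) :
    Tendsto (fun j : ℕ => Real.smoothTransition (j * r)) atTop (𝓝 (if 0 < r then 1 else 0)) := by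
  split_ifs with h
  · obtain ⟨k, hk⟩ := exists_nat_ge r⁻¹
    refine tendsto_const_nhds.congr' ?_
    filter_upwards [eventually_ge_atTop k] with j hj
    rw [Real.smoothTransition.one_of_one_le]
    have : r⁻¹ ≤ j := hk.trans (by exact_mod_cast hj)
    rwa [inv_le_iff_one_le_mul₀ h] at this
  · refine tendsto_const_nhds.congr fun j => ?_
    rw [Real.smoothTransition.zero_of_nonpos]
    exact mul_nonpos_of_nonneg_of_nonpos (Nat.cast_nonneg j) (not_lt.1 h)

namespace ClassicalPositive

theorem neg_integral_evolutionRate_pos_le (hΩ : IsOpen Ω) (hΩf : volume Ω ≠ ⊤) (hp : 1 < p)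
    (hU : ClassicalPositive p Ω U) (hW : ClassicalPositive p Ω W) (hV : ContinuousOn V Ω)
    (hφ : ContDiff ℝ 1 φ) (hc : HasCompactSupport φ) (hs : tsupport φ ⊆ Ω) {N : ℝ}
    (hN : ∀ x, |evolutionRate p V (fun x => |φ x| ^ p) W x| ≤ N) {θ : ℝ} (hθ : 0 < θ) :
    ∫ x, (if 0 < W x ^ θ / θ * |φ x| ^ p - U x ^ θ / θ * |φ x| ^ p
        then -evolutionRate p V (fun x => |φ x| ^ p) U x else 0)
      ≤ N * volume.real Ω + 2 * (∫ x, (p - 1) * ‖logGrad W x‖ ^ p * |φ x| ^ p)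
        + 2 * ∫ x, ‖gradient φ x‖ ^ p := by
  have hψ := contDiff_abs_rpow hp hφ
  have hψc := hasCompactSupport_abs_rpow hp hc
  have hψs := (tsupport_abs_rpow_subset hp).trans hs
  have hI := hU.integrable_evolutionRate hΩ hV hψ.continuous hψc hψs
  have hlogU := hU.contDiffOn_log.continuousOn
  have hlogW := hW.contDiffOn_log.continuousOn
  have hlim : Tendsto (fun j : ℕ => ∫ x, -evolutionRate p V (fun x => |φ x| ^ p) U x *
      Real.smoothTransition (j * (Real.log (W x) - Real.log (U x)))) atTop
      (𝓝 (∫ x, (if 0 < W x ^ θ / θ * |φ x| ^ p - U x ^ θ / θ * |φ x| ^ p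
        then -evolutionRate p V (fun x => |φ x| ^ p) U x else 0))) := by
    refine tendsto_integral_of_dominated_convergence
      (fun x => ‖evolutionRate p V (fun x => |φ x| ^ p) U x‖) (fun j => ?_) hI.norm (fun j => ?_) ?_
    · refine Continuous.aestronglyMeasurable (continuous_of_tsupport_subset hΩ ?_ ?_)
      · exact (hU.continuous_evolutionRate hΩ hV hψ.continuous hψc hψs).1.continuousOn.neg.mul
          (Real.smoothTransition.continuous.comp_continuousOn
            (continuousOn_const.mul (hlogW.sub hlogU)))
      · refine (tsupport_subset_of_forall_zero fun x hx => ?_).trans hψs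
        rw [evolutionRate_eq_zero (image_eq_zero_of_notMem_tsupport hx), neg_zero, zero_mul]
    · refine .of_forall fun x => ?_
      rw [norm_mul, norm_neg, Real.norm_of_nonneg (Real.smoothTransition.nonneg _)]
      exact mul_le_of_le_one_right (norm_nonneg _) (Real.smoothTransition.le_one _)
    · refine .of_forall fun x => ?_
      by_cases hx : |φ x| ^ p = 0
      · have h0 : evolutionRate p V (fun x => |φ x| ^ p) U x = 0 := evolutionRate_eq_zero hx
        simp [h0]
      · have hφx : 0 < |φ x| ^ p := lt_of_le_of_ne (by positivity) (Ne.symm hx)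
        have hxΩ : x ∈ Ω := hψs (subset_closure hx)
        have hiff : 0 < W x ^ θ / θ * |φ x| ^ p - U x ^ θ / θ * |φ x| ^ p
            ↔ 0 < Real.log (W x) - Real.log (U x) := by
          rw [sub_pos, sub_pos, mul_lt_mul_iff_left₀ hφx, div_lt_div_iff_of_pos_right hθ,
            Real.rpow_lt_rpow_iff (hU.pos x hxΩ).le (hW.pos x hxΩ).le hθ,
            Real.log_lt_log_iff (hU.pos x hxΩ) (hW.pos x hxΩ)]
        have := (tendsto_smoothTransition_nat_mul (Real.log (W x) - Real.log (U x))).const_mul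
          (-evolutionRate p V (fun x => |φ x| ^ p) U x)
        simpa [hiff] using this
  refine le_of_tendsto hlim (.of_forall fun j => ?_)
  refine hU.neg_integral_evolutionRate_mul_le (g := fun r => Real.smoothTransition (j * r))
    hΩ hΩf hp hW hV hφ hc hs hN ?_ ?_ (fun _ => Real.smoothTransition.nonneg _)
    (fun _ => Real.smoothTransition.le_one _)
  · exact (Real.smoothTransition.contDiff (n := 1)).comp (contDiff_const.mul contDiff_id)
  · exact Real.smoothTransition.monotone.comp (monotone_mul_left_of_nonneg (Nat.cast_nonneg j))

theorem exists_bound_neg_integral_evolutionRate_pos (hΩ : IsOpen Ω) (hΩf : volume Ω ≠ ⊤)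
    (hp : 1 < p) (hV : ContinuousOn V Ω) (hφ : ContDiff ℝ 1 φ) (hc : HasCompactSupport φ)
    (hs : tsupport φ ⊆ Ω) {θ : ℝ} (hθ : 0 < θ) :
    ∃ C : ℕ → ℝ, ∀ (N : ℕ) (U W : EuclideanSpace ℝ (Fin n) → ℝ), ClassicalPositive p Ω U →
      ClassicalPositive p Ω W → (∀ x, |evolutionRate p V (fun x => |φ x| ^ p) W x| ≤ N) →
      ∫ x, (if 0 < W x ^ θ / θ * |φ x| ^ p - U x ^ θ / θ * |φ x| ^ p
        then -evolutionRate p V (fun x => |φ x| ^ p) U x else 0) ≤ C N := by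
  obtain ⟨K, -, hK⟩ := exists_young_rpow_half hp
  refine ⟨fun N => N * volume.real Ω + 2 * (2 * (N * volume.real Ω - (∫ x, V x * |φ x| ^ p)
    + K * ∫ x, ‖gradient φ x‖ ^ p)) + 2 * ∫ x, ‖gradient φ x‖ ^ p, fun N U W hU hW hN => ?_⟩
  have h1 := hU.neg_integral_evolutionRate_pos_le hΩ hΩf hp hW hV hφ hc hs hN hθ
  have h2 := hW.integral_logGrad_le hΩ hΩf hp hV hφ hc hs hK hN
  simp only
  linarith

end ClassicalPositive

end EnergyLimit

section Evolution

open Filter Topology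

/-- The identity on `(0, T)`, extended by the constant `T / 2`. -/
noncomputable def clampTime (T τ : ℝ) : ℝ := open Classical in if τ ∈ Ioo 0 T then τ else T / 2

theorem clampTime_mem {T : ℝ} (hT : 0 < T) (τ : ℝ) : clampTime T τ ∈ Ioo 0 T := by
  unfold clampTime
  split_ifs with h
  · exact h
  · constructor <;> linarith

theorem clampTime_of_mem {T τ : ℝ} (h : τ ∈ Ioo 0 T) : clampTime T τ = τ := if_pos h

theorem measurable_uncurry_clampTime {X : Type*} [MeasurableSpace X] {T : ℝ} (hT : 0 < T)
    {g : ℝ → X → ℝ} (hc : ∀ x, ContinuousOn (fun τ => g τ x) (Ioo 0 T))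
    (hm : ∀ τ ∈ Ioo 0 T, Measurable (g τ)) :
    Measurable (Function.uncurry fun τ x => g (clampTime T τ) x) := by
  have h1 : Measurable (Function.uncurry fun (τ : Ioo (0 : ℝ) T) x => g τ x) :=
    measurable_uncurry_of_continuous_of_measurable
      (fun x => continuousOn_iff_continuous_domRestrict.1 (hc x)) fun τ => hm τ τ.2
  have h2 : Measurable (clampTime T) :=
    Measurable.ite measurableSet_Ioo measurable_id measurable_const
  have h3 : Measurable fun τ => (⟨clampTime T τ, clampTime_mem hT τ⟩ : Ioo (0 : ℝ) T) :=
    h2.subtype_mk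
  exact h1.comp ((h3.comp measurable_fst).prodMk measurable_snd)

theorem rpow_sub_min_rpow_le {v L θ : ℝ} (hv : 0 < v) (hL : 0 < L) (hθ : 0 < θ) (hθ1 : θ < 1) :
    0 ≤ v ^ θ - min v L ^ θ ∧ v ^ θ - min v L ^ θ ≤ v * L ^ (θ - 1) := by
  rcases le_total v L with h | h
  · rw [min_eq_left h, sub_self]
    exact ⟨le_rfl, by positivity⟩
  · rw [min_eq_right h]
    refine ⟨sub_nonneg.2 (Real.rpow_le_rpow hL.le h hθ.le), ?_⟩
    have h1 : v ^ θ = v * v ^ (θ - 1) := by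
      rw [mul_comm, ← Real.rpow_add_one hv.ne']; congr 1; ring
    have h2 : v ^ (θ - 1) ≤ L ^ (θ - 1) := Real.rpow_le_rpow_of_nonpos hL h (by linarith)
    have h3 : 0 < L ^ θ := by positivity
    have h4 := mul_le_mul_of_nonneg_left h2 hv.le
    linarith

variable {n : ℕ} {p T : ℝ} {Ω : Set (EuclideanSpace ℝ (Fin n))}
  {V φ : EuclideanSpace ℝ (Fin n) → ℝ} {u : ℝ → EuclideanSpace ℝ (Fin n) → ℝ}

/-- Positive classical solutions of `∂ₜu = Δ_p u + V u^{p-1}` on `Ω × (0, T)` of bounded mass. -/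
structure PositiveSolution (p T : ℝ) (Ω : Set (EuclideanSpace ℝ (Fin n)))
    (V : EuclideanSpace ℝ (Fin n) → ℝ) (u : ℝ → EuclideanSpace ℝ (Fin n) → ℝ) : Prop where
  classical : ∀ t ∈ Ioo 0 T, ClassicalPositive p Ω (u t)
  contDiffOn_time : ∀ x ∈ Ω, ContDiffOn ℝ 1 (fun t => u t x) (Ioo 0 T)
  equation : ∀ t ∈ Ioo 0 T, ∀ x ∈ Ω,
    deriv (fun s => u s x) t = pLaplacian p (u t) x + V x * u t x ^ (p - 1)
  integrableOn : ∀ t ∈ Ioo 0 T, IntegrableOn (u t) Ω volume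
  mass_le : ∃ M : ℝ, ∀ t ∈ Ioo 0 T, ∫ x in Ω, u t x ≤ M

namespace PositiveSolution

theorem continuousOn_time (hu : PositiveSolution p T Ω V u) {x} (hx : x ∈ Ω) :
    ContinuousOn (fun t => u t x) (Ioo 0 T) := (hu.contDiffOn_time x hx).continuousOn

theorem hasDerivAt_time (hu : PositiveSolution p T Ω V u) {x} (hx : x ∈ Ω) {t : ℝ}
    (ht : t ∈ Ioo 0 T) : HasDerivAt (fun s => u s x) (deriv (fun s => u s x) t) t :=
  (((hu.contDiffOn_time x hx).contDiffAt (isOpen_Ioo.mem_nhds ht)).differentiableAt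
    one_ne_zero).hasDerivAt

theorem evolutionRate_eq_deriv (hu : PositiveSolution p T Ω V u) {x} (hx : x ∈ Ω) {t : ℝ}
    (ht : t ∈ Ioo 0 T) (ψ : EuclideanSpace ℝ (Fin n) → ℝ) :
    evolutionRate p V ψ (u t) x = u t x ^ (1 - p) * deriv (fun s => u s x) t * ψ x := by
  have h0 := (hu.classical t ht).pos x hx
  have e : u t x ^ (1 - p) * u t x ^ (p - 1) = 1 := by rw [← Real.rpow_add h0]; simp
  rw [evolutionRate, hu.equation t ht x hx]
  linear_combination (-V x * ψ x) * e

theorem continuousOn_integral_rpow (hΩ : IsOpen Ω) (hu : PositiveSolution p T Ω V u)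
    {ψ : EuclideanSpace ℝ (Fin n) → ℝ} (hψ : Continuous ψ) (hψ0 : ∀ x, 0 ≤ ψ x)
    (hc : HasCompactSupport ψ) (hs : tsupport ψ ⊆ Ω) {θ : ℝ} (hθ : 0 < θ) (hθ1 : θ < 1) :
    ContinuousOn (fun t => ∫ x in Ω, u t x ^ θ / θ * ψ x) (Ioo 0 T) := by
  obtain ⟨M, hM⟩ := hu.mass_le
  obtain ⟨B, hB⟩ := hc.exists_bound_of_continuous hψ
  have hz : ∀ x, x ∉ tsupport ψ → ψ x = 0 := fun x hx => image_eq_zero_of_notMem_tsupport hx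
  have hI : ∀ t ∈ Ioo 0 T, Integrable fun x => u t x ^ θ / θ * ψ x := fun t ht =>
    integrable_of_zero_off_tsupport hΩ
      ((((hu.classical t ht).continuousOn_rpow θ).div_const θ).mul hψ.continuousOn) hc hs
      fun x hx => by simp [hz x hx]
  have hIL : ∀ t ∈ Ioo 0 T, ∀ L : ℝ, Integrable fun x => min (u t x) L ^ θ / θ * ψ x :=
    fun t ht L => integrable_of_zero_off_tsupport hΩ
      (((((hu.classical t ht).contDiffOn.continuousOn.inf continuousOn_const).rpow_const
        fun _ _ => Or.inr hθ.le).div_const θ).mul hψ.continuousOn) hc hs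
      fun x hx => by simp [hz x hx]
  refine TendstoUniformlyOn.continuousOn (p := atTop)
    (F := fun (L : ℝ) t => ∫ x in Ω, min (u t x) L ^ θ / θ * ψ x) ?_ ?_
  · rw [Metric.tendstoUniformlyOn_iff]
    intro ε hε
    have hlim : Tendsto (fun L : ℝ => L ^ (θ - 1) * (M / θ * B)) atTop (𝓝 0) := by
      have := (tendsto_rpow_neg_atTop (y := 1 - θ) (by linarith)).mul_const (M / θ * B)
      simpa [neg_sub] using this
    filter_upwards [eventually_gt_atTop 0, hlim.eventually_lt_const hε] with L hL hLε t ht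
    refine lt_of_le_of_lt ?_ hLε
    rw [Real.dist_eq, ← integral_sub (hI t ht).integrableOn (hIL t ht L).integrableOn]
    have hpt : ∀ x ∈ Ω, ‖u t x ^ θ / θ * ψ x - min (u t x) L ^ θ / θ * ψ x‖
        ≤ L ^ (θ - 1) / θ * B * u t x := by
      intro x hx
      have h0 := (hu.classical t ht).pos x hx
      obtain ⟨h1, h2⟩ := rpow_sub_min_rpow_le h0 hL hθ hθ1
      have hb : ψ x ≤ B := (le_abs_self _).trans (hB x)
      rw [show u t x ^ θ / θ * ψ x - min (u t x) L ^ θ / θ * ψ x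
        = (u t x ^ θ - min (u t x) L ^ θ) / θ * ψ x by ring,
        Real.norm_of_nonneg (mul_nonneg (by positivity) (hψ0 x))]
      calc _ ≤ u t x * L ^ (θ - 1) / θ * B := by gcongr; exact hψ0 x
        _ = _ := by ring
    have hB0 : 0 ≤ B := (norm_nonneg _).trans (hB 0)
    refine (norm_integral_le_of_norm_le ((hu.integrableOn t ht).const_mul _)
      ((ae_restrict_iff' hΩ.measurableSet).2 (.of_forall hpt))).trans ?_
    rw [integral_const_mul]
    calc _ ≤ L ^ (θ - 1) / θ * B * M := by gcongr; exact hM t ht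
      _ = _ := by ring
  · refine Eventually.frequently ?_
    filter_upwards [eventually_gt_atTop 0] with L hL
    refine continuousOn_of_dominated (bound := fun x => L ^ θ / θ * ψ x)
      (fun t ht => (hIL t ht L).integrableOn.aestronglyMeasurable) (fun t ht => ?_)
      ((hψ.integrable_of_hasCompactSupport hc).const_mul _).integrableOn
      ((ae_restrict_iff' hΩ.measurableSet).2 (.of_forall fun x hx => ?_))
    · refine (ae_restrict_iff' hΩ.measurableSet).2 (.of_forall fun x hx => ?_)
      have h0 := (hu.classical t ht).pos x hx
      have hm : 0 < min (u t x) L := lt_min h0 hL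
      rw [Real.norm_of_nonneg (mul_nonneg (by positivity) (hψ0 x))]
      have := min_le_right (u t x) L
      have := hψ0 x
      gcongr
    · exact (((((hu.continuousOn_time hx).inf continuousOn_const).rpow_const
        fun _ _ => Or.inr hθ.le).div_const θ).mul continuousOn_const)

theorem separateEvolution (hΩ : IsOpen Ω) (hT : 0 < T) (hp : 1 < p) (hp2 : p < 2)
    (hV : ContinuousOn V Ω) (hu : PositiveSolution p T Ω V u)
    {ψ : EuclideanSpace ℝ (Fin n) → ℝ} (hψ : Continuous ψ) (hψ0 : ∀ x, 0 ≤ ψ x)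
    (hc : HasCompactSupport ψ) (hs : tsupport ψ ⊆ Ω) :
    SeparateEvolution (volume.restrict Ω) T
      (fun t x => u (clampTime T t) x ^ (2 - p) / (2 - p) * ψ x)
      (fun t x => evolutionRate p V ψ (u (clampTime T t)) x) := by
  have hz : ∀ x, x ∉ Ω → ψ x = 0 := fun x hx =>
    image_eq_zero_of_notMem_tsupport fun h => hx (hs h)
  have hθ : 0 < 2 - p := by linarith
  have hcont : ∀ t ∈ Ioo 0 T, Continuous (fun x => u t x ^ (2 - p) / (2 - p) * ψ x) ∧
      HasCompactSupport fun x => u t x ^ (2 - p) / (2 - p) * ψ x := fun t ht =>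
    continuous_and_hasCompactSupport hΩ
      ((((hu.classical t ht).continuousOn_rpow _).div_const _).mul hψ.continuousOn) hc hs
      fun x hx => by simp [image_eq_zero_of_notMem_tsupport hx]
  have hrate := fun t (ht : t ∈ Ioo 0 T) =>
    (hu.classical t ht).continuous_evolutionRate hΩ hV hψ hc hs
  have hrc : ∀ x, ContinuousOn (fun τ => evolutionRate p V ψ (u τ) x) (Ioo 0 T) := fun x => by
    by_cases hx : x ∈ Ω
    · refine ContinuousOn.congr (f := fun t => u t x ^ (1 - p) * deriv (fun s => u s x) t * ψ x)
        ?_ fun t ht => hu.evolutionRate_eq_deriv hx ht ψ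
      refine (((hu.continuousOn_time hx).rpow_const fun t ht =>
        Or.inl ((hu.classical t ht).pos x hx).ne').mul ?_).mul continuousOn_const
      exact (hu.contDiffOn_time x hx).continuousOn_deriv_of_isOpen isOpen_Ioo le_rfl
    · exact continuousOn_const.congr fun t _ => evolutionRate_eq_zero (hz x hx)
  refine ⟨fun t ht x => ?_, fun x => ?_, ?_, ?_, fun t ht x => ?_, fun t ht => ?_, fun t ht => ?_,
    ?_⟩
  · simp only [clampTime_of_mem ht]
    by_cases hx : x ∈ Ω
    · have h0 := (hu.classical t ht).pos x hx
      have h := ((((hu.hasDerivAt_time hx ht).rpow_const (p := 2 - p) (Or.inl h0.ne')).div_const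
        (2 - p)).mul_const (ψ x))
      have h' := h.congr_of_eventuallyEq
        (f₁ := fun σ => u (clampTime T σ) x ^ (2 - p) / (2 - p) * ψ x) (by
          filter_upwards [isOpen_Ioo.mem_nhds ht] with σ hσ
          rw [clampTime_of_mem hσ])
      refine h'.congr_deriv ?_
      rw [hu.evolutionRate_eq_deriv hx ht, show 2 - p - 1 = 1 - p by ring]
      field_simp
    · simp only [hz x hx, mul_zero]
      rw [evolutionRate_eq_zero (hz x hx)]
      exact hasDerivAt_const t 0
  · exact (hrc x).congr fun t ht => by simp only [clampTime_of_mem ht]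
  · exact measurable_uncurry_clampTime hT hrc fun t ht => (hrate t ht).1.measurable
  · refine measurable_uncurry_clampTime (g := fun t x => u t x ^ (2 - p) / (2 - p) * ψ x) hT
      (fun x => ?_) fun t ht => (hcont t ht).1.measurable
    by_cases hx : x ∈ Ω
    · exact ((((hu.continuousOn_time hx).rpow_const fun t ht =>
        Or.inl ((hu.classical t ht).pos x hx).ne').div_const _).mul continuousOn_const)
    · simp only [hz x hx, mul_zero]; exact continuousOn_const
  · by_cases hx : x ∈ Ω
    · have := (hu.classical _ (clampTime_mem hT t)).pos x hx
      exact mul_nonneg (by positivity) (hψ0 x)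
    · simp [hz x hx]
  · obtain ⟨h1, h2⟩ := hcont _ (clampTime_mem hT t)
    exact (h1.integrable_of_hasCompactSupport h2).integrableOn
  · obtain ⟨h1, h2⟩ := hrate _ (clampTime_mem hT t)
    obtain ⟨B, hB⟩ := h2.exists_bound_of_continuous h1
    obtain ⟨N, hN⟩ := exists_nat_ge B
    exact ⟨N, fun x => (hB x).trans hN⟩
  · exact (hu.continuousOn_integral_rpow hΩ hψ hψ0 hc hs hθ (by linarith)).congr
      fun t ht => by simp only [clampTime_of_mem ht]

theorem mul_le_integral_rpow_sub (hΩ : IsOpen Ω) (hΩf : volume Ω ≠ ⊤) (hT : 0 < T) (hp : 1 < p)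
    (hp2 : p < 2) (hV : ContinuousOn V Ω) (hu : PositiveSolution p T Ω V u)
    (hφ : ContDiff ℝ 1 φ) (hc : HasCompactSupport φ) (hs : tsupport φ ⊆ Ω) {r t : ℝ}
    (hr : r ∈ Ioo 0 T) (ht : t ∈ Ioo 0 T) (hrt : r < t) :
    ((∫ x, V x * |φ x| ^ p) - ∫ x, ‖gradient φ x‖ ^ p) * (t - r)
      ≤ (∫ x in Ω, u t x ^ (2 - p) / (2 - p) * |φ x| ^ p)
        - ∫ x in Ω, u r x ^ (2 - p) / (2 - p) * |φ x| ^ p := by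
  have hψ := contDiff_abs_rpow hp hφ
  have hψc := hasCompactSupport_abs_rpow hp hc
  have hψs := (tsupport_abs_rpow_subset hp).trans hs
  have : IsFiniteMeasure (volume.restrict Ω) := ⟨by simpa using hΩf.lt_top⟩
  have hz : ∀ U x, x ∉ Ω → evolutionRate p V (fun x => |φ x| ^ p) U x = 0 := fun U x hx =>
    evolutionRate_eq_zero (image_eq_zero_of_notMem_tsupport (f := fun x => |φ x| ^ p)
      fun h => hx (hψs h))
  obtain ⟨C, hC⟩ := ClassicalPositive.exists_bound_neg_integral_evolutionRate_pos hΩ hΩf hp hV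
    hφ hc hs (θ := 2 - p) (by linarith)
  have h := (hu.separateEvolution hΩ hT hp hp2 hV hψ.continuous (fun x => by positivity) hψc
    hψs).mul_le_integral_sub (A := (∫ x, V x * |φ x| ^ p) - ∫ x, ‖gradient φ x‖ ^ p) (C := C)
    (fun τ hτ => ?_) (fun N s hs' hN τ hτ => ?_) hr ht hrt
  · simpa only [clampTime_of_mem hr, clampTime_of_mem ht] using h
  · simp only [clampTime_of_mem hτ]
    rw [setIntegral_eq_integral_of_forall_compl_eq_zero fun x hx => hz (u τ) x hx]
    exact (hu.classical τ hτ).le_integral_evolutionRate hΩ hp hV hφ hc hs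
  · simp only [clampTime_of_mem hτ, clampTime_of_mem hs'] at hN ⊢
    rw [setIntegral_eq_integral_of_forall_compl_eq_zero fun x hx => by
      rw [hz (u τ) x hx, neg_zero, ite_self]]
    exact hC N (u τ) (u s) (hu.classical τ hτ) (hu.classical s hs') hN

end PositiveSolution

end Evolution

section Sobolev

open scoped ENNReal NNReal

variable {n : ℕ} {p : ℝ} {Ω : Set (EuclideanSpace ℝ (Fin n))}
  {U : EuclideanSpace ℝ (Fin n) → ℝ}

theorem exists_lintegral_mul_rpow_le (hp : 1 < p) (hpn : p < n) :
    ∃ K : ℝ≥0, ∀ (g : EuclideanSpace ℝ (Fin n) → ℝ≥0∞), AEMeasurable g →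
      ∀ φ : EuclideanSpace ℝ (Fin n) → ℝ, ContDiff ℝ 1 φ → HasCompactSupport φ →
        ∫⁻ x, g x * ‖φ x‖ₑ ^ p
          ≤ (∫⁻ x, g x ^ (n / p)) ^ (p / n) * (K * ∫⁻ x, ‖fderiv ℝ φ x‖ₑ ^ p) := by
  have hp0 : 0 < p := by linarith
  have hn0 : (0 : ℝ) < n := by linarith
  have hnp : 0 < n - p := by linarith
  set c := eLpNormLESNormFDerivOfEqInnerConst
    (volume : Measure (EuclideanSpace ℝ (Fin n))) p with hcdef
  refine ⟨c ^ p, fun g hg φ hφ hc => ?_⟩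
  set q : ℝ := n * p / (n - p) with hq
  have hq0 : 0 < q := by positivity
  obtain ⟨P, hP⟩ : ∃ P : ℝ≥0, (P : ℝ) = p := ⟨⟨p, hp0.le⟩, rfl⟩
  obtain ⟨Q, hQ⟩ : ∃ Q : ℝ≥0, (Q : ℝ) = q := ⟨⟨q, hq0.le⟩, rfl⟩
  have gns := eLpNorm_le_eLpNorm_fderiv_of_eq_inner
    (volume : Measure (EuclideanSpace ℝ (Fin n))) hφ hc (p := P) (p' := Q)
    (by rw [← NNReal.coe_le_coe, hP]; exact_mod_cast hp.le)
    (by simpa using (by exact_mod_cast hn0 : 0 < n))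
    (by rw [NNReal.coe_inv, hQ, hP, finrank_euclideanSpace, Fintype.card_fin, hq]; field_simp)
  have hconj : (n / p : ℝ).HolderConjugate (n / (n - p)) := by
    rw [Real.holderConjugate_iff]
    refine ⟨(one_lt_div hp0).2 hpn, ?_⟩
    field_simp
    ring
  have holder := ENNReal.lintegral_mul_le_Lp_mul_Lq volume hconj hg
    (g := fun x => ‖φ x‖ₑ ^ p) (hφ.continuous.aemeasurable.enorm.pow_const p)
  simp only [Pi.mul_apply] at holder
  refine holder.trans ?_
  rw [one_div_div]
  gcongr
  have hP0 : (P : ℝ≥0∞) ≠ 0 := by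
    rw [ENNReal.coe_ne_zero, ← NNReal.coe_ne_zero, hP]; exact hp0.ne'
  have hQ0 : (Q : ℝ≥0∞) ≠ 0 := by
    rw [ENNReal.coe_ne_zero, ← NNReal.coe_ne_zero, hQ]; exact hq0.ne'
  rw [eLpNorm_eq_lintegral_rpow_enorm_toReal hQ0 ENNReal.coe_ne_top,
    eLpNorm_eq_lintegral_rpow_enorm_toReal hP0 ENNReal.coe_ne_top] at gns
  simp only [ENNReal.coe_toReal, hP, hQ] at gns
  have h1 : ∀ x, (‖φ x‖ₑ ^ p) ^ (n / (n - p)) = ‖φ x‖ₑ ^ q := fun x => by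
    rw [← ENNReal.rpow_mul]; congr 1; rw [hq]; ring
  simp_rw [h1]
  have h2 := ENNReal.rpow_le_rpow gns hp0.le
  rw [ENNReal.mul_rpow_of_nonneg _ _ hp0.le, ← ENNReal.rpow_mul, ← ENNReal.rpow_mul,
    one_div_mul_cancel hp0.ne', ENNReal.rpow_one] at h2
  rw [ENNReal.coe_rpow_of_nonneg _ hp0.le]
  rwa [show 1 / q * p = 1 / (n / (n - p)) by rw [hq]; field_simp] at h2

theorem exists_lintegral_superlevel_lt (hΩ : IsOpen Ω) (hi : IntegrableOn U Ω)
    {η : ℝ≥0∞} (hη : η ≠ 0) :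
    ∃ L : ℝ, 1 ≤ L ∧ ∫⁻ x in Ω ∩ {x | L < U x}, ENNReal.ofReal (U x) < η := by
  have hfin : ∫⁻ x in Ω, ENNReal.ofReal (U x) ≠ ⊤ :=
    (lt_of_le_of_lt (lintegral_mono fun x => Real.ofReal_le_enorm _) hi.2).ne
  obtain ⟨δ, hδ, h⟩ := exists_pos_setLIntegral_lt_of_measure_lt hfin hη
  set M := ∫⁻ x in Ω, ENNReal.ofReal (U x) with hM
  obtain ⟨k, hk⟩ := ENNReal.exists_nat_mul_gt hδ.ne' hfin
  have hk1 : (0 : ℝ) < max k 1 := by positivity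
  refine ⟨max k 1, le_max_right _ _, ?_⟩
  have hlt : (volume.restrict Ω) {x | (max k 1 : ℝ) < U x} < δ := by
    have h1 : (volume.restrict Ω) {x | (max k 1 : ℝ) < U x}
        ≤ (volume.restrict Ω) {x | ENNReal.ofReal (max k 1) ≤ ENNReal.ofReal (U x)} :=
      measure_mono fun x hx => ENNReal.ofReal_le_ofReal (le_of_lt hx)
    have h2 := meas_ge_le_lintegral_div hi.aemeasurable.ennreal_ofReal
      (ε := ENNReal.ofReal (max k 1)) (by simp) ENNReal.ofReal_ne_top
    refine (h1.trans h2).trans_lt ?_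
    rw [ENNReal.div_lt_iff (Or.inl (by simp)) (Or.inl ENNReal.ofReal_ne_top), mul_comm]
    refine hk.trans_le ?_
    gcongr
    rw [← ENNReal.ofReal_natCast]
    exact ENNReal.ofReal_le_ofReal (le_max_left _ _)
  have := h _ hlt
  rwa [Measure.restrict_restrict' hΩ.measurableSet, inter_comm] at this

theorem exists_integral_rpow_mul_le (hp : 1 < p) (hpn : p < n) (hΩ : IsOpen Ω)
    (hUc : ContinuousOn U Ω) (hU0 : ∀ x ∈ Ω, 0 < U x) (hi : IntegrableOn U Ω)
    {θ : ℝ} (hθ : 0 < θ) (hθp : θ * (n / p) ≤ 1) {δ : ℝ} (hδ : 0 < δ) :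
    ∃ C : ℝ, ∀ φ : EuclideanSpace ℝ (Fin n) → ℝ, ContDiff ℝ 1 φ → HasCompactSupport φ →
      ∫ x in Ω, U x ^ θ * |φ x| ^ p
        ≤ δ * (∫ x, ‖gradient φ x‖ ^ p) + C * ∫ x, |φ x| ^ p := by
  have hp0 : 0 < p := by linarith
  have hn0 : (0 : ℝ) < n := by linarith
  have hnp0 : 0 < n / p := by positivity
  obtain ⟨K, hK⟩ := exists_lintegral_mul_rpow_le hp hpn
  have hη0 : ENNReal.ofReal (δ / (K + 1)) ^ (n / p) ≠ 0 := by
    rw [Ne, ENNReal.rpow_eq_zero_iff_of_pos hnp0, ENNReal.ofReal_eq_zero, not_le]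
    positivity
  obtain ⟨L, hL1, hL⟩ := exists_lintegral_superlevel_lt hΩ hi hη0
  set S := Ω ∩ {x | L < U x} with hS
  have hSm : MeasurableSet S := (hUc.isOpen_inter_preimage hΩ isOpen_Ioi).measurableSet
  set g : EuclideanSpace ℝ (Fin n) → ℝ≥0∞ :=
    S.indicator fun x => ENNReal.ofReal (U x ^ θ) with hg
  have hgm : AEMeasurable g := (aemeasurable_indicator_iff hSm).2
    (((hUc.mono inter_subset_left).rpow_const fun _ _ => Or.inr hθ.le).aemeasurable
      hSm).ennreal_ofReal
  have hgi : (∫⁻ x, g x ^ (n / p)) ^ (p / n) * K ≤ ENNReal.ofReal δ := by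
    have h1 : ∫⁻ x, g x ^ (n / p) ≤ ENNReal.ofReal (δ / (K + 1)) ^ (n / p) := by
      refine le_trans ?_ hL.le
      rw [← lintegral_indicator hSm]
      refine lintegral_mono fun x => ?_
      by_cases hx : x ∈ S
      · have hx1 : 1 ≤ U x := hL1.trans hx.2.le
        simp only [hg, indicator_of_mem hx]
        rw [ENNReal.ofReal_rpow_of_nonneg (by positivity) hnp0.le,
          ← Real.rpow_mul (by linarith)]
        refine ENNReal.ofReal_le_ofReal ?_
        exact (Real.rpow_le_rpow_of_exponent_le hx1 hθp).trans_eq (Real.rpow_one _)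
      · simp [hg, hx, hnp0]
    have h2 := ENNReal.rpow_le_rpow h1 (by positivity : 0 ≤ p / n)
    rw [← ENNReal.rpow_mul, div_mul_div_cancel₀ hp0.ne', div_self hn0.ne', ENNReal.rpow_one] at h2
    calc _ ≤ ENNReal.ofReal (δ / (K + 1)) * K := by gcongr
      _ = ENNReal.ofReal (δ / (K + 1) * K) := by
        rw [ENNReal.ofReal_mul (by positivity), ENNReal.ofReal_coe_nnreal]
      _ ≤ _ := by
        refine ENNReal.ofReal_le_ofReal ?_
        rw [div_mul_eq_mul_div, div_le_iff₀ (by positivity)]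
        nlinarith [K.2]
  refine ⟨L ^ θ, fun φ hφ hc => ?_⟩
  have hψ := ((contDiff_abs_rpow hp hφ).continuous.integrable_of_hasCompactSupport
    (hasCompactSupport_abs_rpow hp hc) : Integrable (fun x => |φ x| ^ p) volume)
  have hD := integrable_norm_gradient_rpow hp hφ hc
  have e1 : ∀ x, ‖φ x‖ₑ ^ p = ENNReal.ofReal (|φ x| ^ p) := fun x => by
    rw [Real.enorm_eq_ofReal_abs, ENNReal.ofReal_rpow_of_nonneg (abs_nonneg _) hp0.le]
  have e2 : ∀ x, ‖fderiv ℝ φ x‖ₑ ^ p = ENNReal.ofReal (‖gradient φ x‖ ^ p) := fun x => by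
    rw [norm_gradient_eq, ← ofReal_norm,
      ENNReal.ofReal_rpow_of_nonneg (norm_nonneg _) hp0.le]
  have hgs := hK g hgm φ hφ hc
  simp_rw [e1, e2] at hgs
  rw [← ofReal_integral_eq_lintegral_ofReal hD (.of_forall fun x => by positivity),
    ← mul_assoc] at hgs
  have hmain : ∫⁻ x in Ω, ENNReal.ofReal (U x ^ θ * |φ x| ^ p)
      ≤ ENNReal.ofReal (δ * (∫ x, ‖gradient φ x‖ ^ p) + L ^ θ * ∫ x, |φ x| ^ p) := by
    have h0 : 0 ≤ ∫ x, |φ x| ^ p := integral_nonneg fun x => by positivity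
    have h0' : 0 ≤ ∫ x, ‖gradient φ x‖ ^ p := integral_nonneg fun x => by positivity
    calc _ ≤ ∫⁻ x in Ω, (ENNReal.ofReal (L ^ θ * |φ x| ^ p)
          + g x * ENNReal.ofReal (|φ x| ^ p)) := by
          refine setLIntegral_mono' hΩ.measurableSet fun x hx => ?_
          by_cases hxL : L < U x
          · rw [hg, indicator_of_mem (show x ∈ S from ⟨hx, hxL⟩),
              ← ENNReal.ofReal_mul (Real.rpow_nonneg (hU0 x hx).le _)]
            exact le_add_self
          · refine le_add_right (ENNReal.ofReal_le_ofReal ?_)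
            have := (hU0 x hx).le
            gcongr
            exact not_lt.1 hxL
      _ ≤ ∫⁻ x, (ENNReal.ofReal (L ^ θ * |φ x| ^ p) + g x * ENNReal.ofReal (|φ x| ^ p)) :=
          setLIntegral_le_lintegral _ _
      _ = ENNReal.ofReal (L ^ θ * ∫ x, |φ x| ^ p) + ∫⁻ x, g x * ENNReal.ofReal (|φ x| ^ p) := by
          rw [lintegral_add_left' (hψ.const_mul _).aemeasurable.ennreal_ofReal,
            ← ofReal_integral_eq_lintegral_ofReal (hψ.const_mul _)
              (.of_forall fun x => by positivity), integral_const_mul]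
      _ ≤ ENNReal.ofReal (L ^ θ * ∫ x, |φ x| ^ p)
          + ENNReal.ofReal δ * ENNReal.ofReal (∫ x, ‖gradient φ x‖ ^ p) := by
          gcongr
          exact hgs.trans (by gcongr)
      _ = _ := by
          rw [← ENNReal.ofReal_mul hδ.le, ← ENNReal.ofReal_add (by positivity) (by positivity),
            add_comm]
  have hnn : 0 ≤ δ * (∫ x, ‖gradient φ x‖ ^ p) + L ^ θ * ∫ x, |φ x| ^ p := by
    have h0 : 0 ≤ ∫ x, |φ x| ^ p := integral_nonneg fun x => by positivity
    have h0' : 0 ≤ ∫ x, ‖gradient φ x‖ ^ p := integral_nonneg fun x => by positivity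
    positivity
  have hm : AEStronglyMeasurable (fun x => U x ^ θ * |φ x| ^ p) (volume.restrict Ω) :=
    ((hUc.rpow_const fun _ _ => Or.inr hθ.le).mul
      (contDiff_abs_rpow hp hφ).continuous.continuousOn).aestronglyMeasurable hΩ.measurableSet
  rw [integral_eq_lintegral_of_nonneg_ae ((ae_restrict_iff' hΩ.measurableSet).2
    (.of_forall fun x hx => mul_nonneg (Real.rpow_nonneg (hU0 x hx).le _) (by positivity))) hm]
  exact ENNReal.toReal_le_of_le_ofReal hnn hmain

end Sobolev

/-- **Theorem 4.1** (Euclidean, classical-solution version): if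
`2n/(n+1) ≤ p < 2` and `u > 0` is a classical solution of
`u_t = Δ_p u + V u^{p−1}` on `Ω × (0,T)` with uniformly bounded mass, then
for every `ε ∈ (0,1)` there is a constant `C` with
`∫_Ω (1−ε) V |φ|^p − ∫_Ω ‖∇φ‖^p ≤ C ∫_Ω |φ|^p` for all test functions `φ`.
In particular the normalized quadratic form of `(1−ε)V` is bounded below,
so no such positive solution can exist when `σ_inf^p((1−ε)V) = −∞`. -/
theorem parabolic_nonexistence {n : ℕ} (hn : 2 ≤ n)
    (Ω : Set (EuclideanSpace ℝ (Fin n)))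
    (hΩo : IsOpen Ω) (hΩb : Bornology.IsBounded Ω)
    (p T : ℝ) (hp1 : (2 * n : ℝ) / (n + 1) ≤ p) (hp2 : p < 2) (hT : 0 < T)
    (V : EuclideanSpace ℝ (Fin n) → ℝ) (hV : ContinuousOn V Ω)
    (u : ℝ → EuclideanSpace ℝ (Fin n) → ℝ)
    (hpos : ∀ t ∈ Ioo 0 T, ∀ x ∈ Ω, 0 < u t x)
    (hreg_t : ∀ x ∈ Ω, ContDiffOn ℝ 1 (fun t => u t x) (Ioo 0 T))
    (hreg_x : ∀ t ∈ Ioo 0 T, ContDiffOn ℝ 2 (u t) Ω)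
    (hreg_F : ∀ t ∈ Ioo 0 T, ContDiffOn ℝ 1 (pVF p (u t)) Ω)
    (hPDE : ∀ t ∈ Ioo 0 T, ∀ x ∈ Ω,
      deriv (fun s => u s x) t = pLaplacian p (u t) x + V x * u t x ^ (p - 1))
    (hint : ∀ t ∈ Ioo 0 T, IntegrableOn (u t) Ω volume)
    (hmass : ∃ M : ℝ, ∀ t ∈ Ioo 0 T, ∫ x in Ω, u t x ≤ M) :
    ∀ ε : ℝ, 0 < ε → ε < 1 → ∃ C : ℝ,
      ∀ φ : EuclideanSpace ℝ (Fin n) → ℝ, ContDiff ℝ (⊤ : ℕ∞) φ →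
        HasCompactSupport φ → tsupport φ ⊆ Ω →
        (∫ x in Ω, (1 - ε) * V x * |φ x| ^ p) -
            (∫ x in Ω, ‖gradient φ x‖ ^ p) ≤ C * ∫ x in Ω, |φ x| ^ p := by
  intro ε hε hε1
  have hn' : (2 : ℝ) ≤ n := by exact_mod_cast hn
  have hpn1 : 2 * n ≤ p * (n + 1) := (div_le_iff₀ (by positivity)).1 hp1
  have hp : 1 < p := by nlinarith
  have hpn : p < n := by linarith
  have hθ : 0 < 2 - p := by linarith
  have hκ : 0 < 1 - ε := by linarith
  have hθp : (2 - p) * (n / p) ≤ 1 := by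
    rw [← mul_div_assoc, div_le_one (by linarith)]
    linarith
  have hu : PositiveSolution p T Ω V u :=
    ⟨fun t ht => ⟨hpos t ht, hreg_x t ht, hreg_F t ht⟩, hreg_t, hPDE, hint, hmass⟩
  have hr : T / 3 ∈ Ioo 0 T := by constructor <;> linarith
  have ht : 2 * T / 3 ∈ Ioo 0 T := by constructor <;> linarith
  obtain ⟨C, hC⟩ := exists_integral_rpow_mul_le hp hpn hΩo (hreg_x _ ht).continuousOn
    (hpos _ ht) (hint _ ht) hθ hθp
    (δ := ε / (1 - ε) * (2 - p) * (T / 3)) (by positivity)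
  refine ⟨(1 - ε) * C / ((2 - p) * (T / 3)), fun φ hφ hc hs => ?_⟩
  have hφ1 : ContDiff ℝ 1 φ := hφ.of_le (by exact_mod_cast le_top)
  have hφ0 : ∀ x, x ∉ Ω → φ x = 0 := fun x hx =>
    image_eq_zero_of_notMem_tsupport fun h => hx (hs h)
  have hp0 : p ≠ 0 := by linarith
  have i1 : ∫ x in Ω, (1 - ε) * V x * |φ x| ^ p = (1 - ε) * ∫ x, V x * |φ x| ^ p := by
    rw [setIntegral_eq_integral_of_forall_compl_eq_zero fun x hx => by
      simp [hφ0 x hx, Real.zero_rpow hp0], ← integral_const_mul]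
    simp_rw [mul_assoc]
  have i2 : ∫ x in Ω, ‖gradient φ x‖ ^ p = ∫ x, ‖gradient φ x‖ ^ p :=
    setIntegral_eq_integral_of_forall_compl_eq_zero fun x hx => by
      rw [norm_gradient_eq, fderiv_eq_zero_of_notMem_tsupport fun h => hx (hs h), norm_zero,
        Real.zero_rpow hp0]
  have i3 : ∫ x in Ω, |φ x| ^ p = ∫ x, |φ x| ^ p :=
    setIntegral_eq_integral_of_forall_compl_eq_zero fun x hx => by
      simp [hφ0 x hx, Real.zero_rpow hp0]
  rw [i1, i2, i3]
  have h1 := hu.mul_le_integral_rpow_sub hΩo hΩb.measure_lt_top.ne hT hp hp2 hV hφ1 hc hs hr ht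
    (by linarith)
  have h2 := hC φ hφ1 hc
  have h3 : 0 ≤ ∫ x in Ω, u (T / 3) x ^ (2 - p) / (2 - p) * |φ x| ^ p :=
    setIntegral_nonneg hΩo.measurableSet fun x hx => by
      have := hpos _ hr x hx
      positivity
  have h4 : ∫ x in Ω, u (2 * T / 3) x ^ (2 - p) / (2 - p) * |φ x| ^ p
      = (∫ x in Ω, u (2 * T / 3) x ^ (2 - p) * |φ x| ^ p) / (2 - p) := by
    rw [← integral_div]
    simp_rw [div_mul_eq_mul_div]
  rw [h4] at h1
  set A := ∫ x, V x * |φ x| ^ p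
  set D := ∫ x, ‖gradient φ x‖ ^ p
  set B := ∫ x, |φ x| ^ p
  have h5 : (A - D) * (T / 3) * (2 - p) ≤ ε / (1 - ε) * (2 - p) * (T / 3) * D + C * B := by
    refine le_trans ?_ h2
    rw [← le_div_iff₀ hθ]
    linarith
  have h6 := mul_le_mul_of_nonneg_left h5 hκ.le
  have e6 : (1 - ε) * (ε / (1 - ε) * (2 - p) * (T / 3) * D + C * B)
      = ε * D * ((2 - p) * (T / 3)) + (1 - ε) * C * B := by
    field_simp
  rw [e6] at h6
  rw [div_mul_eq_mul_div, le_div_iff₀ (by positivity)]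
  linarith
end

section
/- Let n ≥ 3, 1 < p < n, let Ω ⊂ ℝⁿ be a bounded open set with 0 ∈ Ω, and let λ > ((n−p)/p)^p. Then the quadratic-form quotient is unbounded below: for every M > 0 there exists a nonzero φ ∈ C_c^∞(Ω \ {0}) with ∫_Ω ‖∇φ‖^p dx − λ ∫_Ω ‖x‖^{−p} |φ|^p dx < −M ∫_Ω |φ|^p dx. -/
open MeasureTheory

section RadialIntegral

variable {E : Type*} [NormedAddCommGroup E] [NormedSpace ℝ E] [FiniteDimensional ℝ E]
  [Nontrivial E] [MeasurableSpace E] [BorelSpace E]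

/-- Logarithmic change of variables on the half-line. -/
theorem integral_Ioi_inv_mul_comp_log {δ r : ℝ} (hδ : 0 < δ) (hr : 0 < r) (G : ℝ → ℝ) :
    ∫ y in Set.Ioi (0 : ℝ), y⁻¹ * G (δ * Real.log (y / r)) = δ⁻¹ * ∫ s, G s := by
  have himage : (fun s : ℝ => r * Real.exp (s / δ)) '' Set.univ = Set.Ioi 0 := by
    ext y
    simp only [Set.image_univ, Set.mem_range, Set.mem_Ioi]
    constructor
    · rintro ⟨s, rfl⟩
      positivity
    · intro hy
      refine ⟨δ * Real.log (y / r), ?_⟩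
      rw [mul_div_cancel_left₀ _ hδ.ne', Real.exp_log (by positivity)]
      field_simp
  have hinj : Set.InjOn (fun s : ℝ => r * Real.exp (s / δ)) Set.univ := by
    intro s _ t _ h
    have h' := Real.exp_injective (mul_left_cancel₀ hr.ne' h)
    field_simp at h'
    exact h'
  rw [← himage, integral_image_eq_integral_abs_deriv_smul MeasurableSet.univ
    (f' := fun s => r * (Real.exp (s / δ) * (1 / δ))) (fun s _ =>
      ((((hasDerivAt_id' s).div_const δ).exp).const_mul r).hasDerivWithinAt) hinj,
    setIntegral_univ, ← integral_const_mul]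
  refine integral_congr_ae (Filter.Eventually.of_forall fun s => ?_)
  have hlog : δ * Real.log (r * Real.exp (s / δ) / r) = s := by
    rw [mul_div_cancel_left₀ _ hr.ne', Real.log_exp]
    field_simp
  simp only [hlog, smul_eq_mul]
  rw [abs_of_pos (by positivity)]
  field_simp

/-- Integral of a function of `log ‖x‖` against the scale-invariant weight `‖x‖ ^ (-dim E)`. -/
theorem integral_norm_rpow_neg_finrank_mul_comp_log (μ : Measure E) [μ.IsAddHaarMeasure]
    {δ r : ℝ} (hδ : 0 < δ) (hr : 0 < r) (G : ℝ → ℝ) :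
    ∫ x : E, ‖x‖ ^ (-(Module.finrank ℝ E : ℝ)) * G (δ * Real.log (‖x‖ / r)) ∂μ =
      Module.finrank ℝ E * μ.real (Metric.ball 0 1) * δ⁻¹ * ∫ s, G s := by
  rw [integral_fun_norm_addHaar μ
    (fun y => y ^ (-(Module.finrank ℝ E : ℝ)) * G (δ * Real.log (y / r))),
    nsmul_eq_mul, smul_eq_mul, mul_assoc, mul_assoc, ← integral_Ioi_inv_mul_comp_log hδ hr]
  congr 2
  refine setIntegral_congr_fun measurableSet_Ioi fun y hy => ?_
  have hy : 0 < y := hy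
  have hdim : 1 ≤ Module.finrank ℝ E := Module.finrank_pos
  simp only [smul_eq_mul]
  rw [← mul_assoc, Real.rpow_neg hy.le, Real.rpow_natCast, ← pow_sub_one_mul (Nat.one_le_iff_ne_zero.1 hdim) y]
  congr 1
  field_simp

end RadialIntegral

/-- The quotient of the one-dimensional forms `∫ |-a χ + δ χ'| ^ p` and `∫ |χ| ^ p` gets below any
constant larger than `a ^ p` as `δ → 0`. -/
theorem exists_integral_abs_drift_rpow_lt {χ : ℝ → ℝ} (hχ : ContDiff ℝ 1 χ)
    (hsupp : HasCompactSupport χ) (hne : χ ≠ 0) {p a c : ℝ} (hp : 0 < p) (ha : 0 ≤ a)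
    (hc : a ^ p < c) :
    ∃ δ : ℝ, 0 < δ ∧ (∫ s, |-a * χ s + δ * deriv χ s| ^ p) < c * ∫ s, |χ s| ^ p := by
  obtain ⟨s₀, hs₀⟩ := Function.ne_iff.1 hne
  have hpos : 0 < ∫ s, |χ s| ^ p := by
    refine Continuous.integral_pos_of_hasCompactSupport_nonneg_nonzero (x := s₀)
      ((hχ.continuous.abs).rpow_const fun _ => Or.inr hp.le)
      (hsupp.comp_left (g := fun t : ℝ => |t| ^ p) (by simp [hp.ne']))
      (fun s => by positivity) ?_
    exact (Real.rpow_pos_of_pos (abs_pos.2 hs₀) p).ne'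
  have hcont : Continuous fun δ : ℝ => ∫ s in tsupport χ, |-a * χ s + δ * deriv χ s| ^ p := by
    refine continuous_parametric_integral_of_continuous ?_ hsupp
    have hχ₀ := hχ.continuous
    have hχ₁ := hχ.continuous_deriv le_rfl
    refine Continuous.rpow_const ?_ fun _ => Or.inr hp.le
    fun_prop
  have heq (δ : ℝ) : ∫ s in tsupport χ, |-a * χ s + δ * deriv χ s| ^ p =
      ∫ s, |-a * χ s + δ * deriv χ s| ^ p := by
    refine setIntegral_eq_integral_of_forall_compl_eq_zero fun s hs => ?_
    have hd : deriv χ s = 0 :=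
      Function.notMem_support.1 fun h => hs (support_deriv_subset h)
    simp [image_eq_zero_of_notMem_tsupport hs, hd, hp.ne']
  simp only [heq] at hcont
  have hzero : (∫ s, |-a * χ s + 0 * deriv χ s| ^ p) < c * ∫ s, |χ s| ^ p := by
    have : ∀ s, |-a * χ s + 0 * deriv χ s| ^ p = a ^ p * |χ s| ^ p := fun s => by
      rw [zero_mul, add_zero, abs_mul, abs_neg, abs_of_nonneg ha,
        Real.mul_rpow ha (abs_nonneg _)]
    simp only [this, integral_const_mul]
    gcongr
  have hev := (hcont.tendsto 0).eventually_lt_const hzero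
  obtain ⟨δ, hlt, hδ⟩ := ((hev.filter_mono nhdsWithin_le_nhds).and
    (self_mem_nhdsWithin (s := Set.Ioi (0 : ℝ)))).exists
  exact ⟨δ, hδ, hlt⟩

/-- The norm of the gradient of a radial function. -/
theorem norm_gradient_comp_norm {E : Type*} [NormedAddCommGroup E] [InnerProductSpace ℝ E]
    [CompleteSpace E] [Nontrivial E] {g : ℝ → ℝ} {g' : ℝ} {x : E} (hx : x ≠ 0)
    (hg : HasDerivAt g g' ‖x‖) : ‖gradient (fun y : E => g ‖y‖) x‖ = |g'| := by
  have hd : DifferentiableAt ℝ (fun y : E => ‖y‖) x := differentiableAt_id.norm ℝ hx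
  have := (hg.comp_hasFDerivAt x hd.hasFDerivAt).fderiv
  rw [← (InnerProductSpace.toDual ℝ E).norm_map, toDual_gradient]
  change ‖fderiv ℝ (g ∘ fun y : E => ‖y‖) x‖ = |g'|
  rw [this, norm_smul, norm_fderiv_norm hd, mul_one, Real.norm_eq_abs]

/-- A power times a cutoff in the logarithmic variable: the radial profile of the test functions
for Hardy's inequality. -/
noncomputable def logCutoffPower (χ : ℝ → ℝ) (a δ r y : ℝ) : ℝ :=
  y ^ (-a) * χ (δ * Real.log (y / r))

section LogCutoffPower

variable {χ : ℝ → ℝ} {a δ r : ℝ}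

theorem hasDerivAt_logCutoffPower (hχ : Differentiable ℝ χ) (hr : 0 < r) {y : ℝ} (hy : 0 < y) :
    HasDerivAt (logCutoffPower χ a δ r)
      (y ^ (-a - 1) * (-a * χ (δ * Real.log (y / r)) + δ * deriv χ (δ * Real.log (y / r)))) y := by
  have hlog : HasDerivAt (fun y => δ * Real.log (y / r)) (δ * ((1 / r) / (y / r))) y :=
    (((hasDerivAt_id y).div_const r).log (div_pos hy hr).ne').const_mul δ
  have h := (Real.hasDerivAt_rpow_const (p := -a) (Or.inl hy.ne')).mul
    ((hχ _).hasDerivAt.comp y hlog)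
  refine h.congr_deriv ?_
  have hpow : y ^ (-a) = y ^ (-a - 1) * y := by
    rw [← Real.rpow_add_one hy.ne', sub_add_cancel]
  simp only [Function.comp]
  rw [hpow]
  field_simp

theorem contDiffAt_logCutoffPower {k : WithTop ℕ∞} (hχ : ContDiff ℝ k χ) (hr : 0 < r) {y : ℝ}
    (hy : 0 < y) : ContDiffAt ℝ k (logCutoffPower χ a δ r) y :=
  (Real.contDiffAt_rpow_const_of_ne hy.ne').mul
    (hχ.contDiffAt.comp y (contDiffAt_const.mul
      ((contDiffAt_id.div_const r).log (div_pos hy hr).ne')))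

variable {E : Type*} [NormedAddCommGroup E]

theorem tsupport_logCutoffPower_norm_subset (hχ : Function.support χ ⊆ Set.Ioo (-2) (-1))
    (hδ : 0 < δ) (hr : 0 < r) :
    tsupport (fun x : E => logCutoffPower χ a δ r ‖x‖) ⊆
      {x | ‖x‖ ∈ Set.Icc (r * Real.exp (-2 / δ)) (r * Real.exp (-1 / δ))} := by
  refine closure_minimal (fun x hx => ?_) (isClosed_Icc.preimage continuous_norm)
  have hmem := hχ (right_ne_zero_of_mul hx)
  have hxr : 0 < ‖x‖ / r := by
    refine lt_of_le_of_ne (by positivity) fun h => ?_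
    rw [← h] at hmem
    norm_num at hmem
  have h₁ : -2 / δ ≤ Real.log (‖x‖ / r) := by
    rw [div_le_iff₀ hδ]
    linarith [hmem.1]
  have h₂ : Real.log (‖x‖ / r) ≤ -1 / δ := by
    rw [le_div_iff₀ hδ]
    linarith [hmem.2]
  rw [Real.le_log_iff_exp_le hxr, le_div_iff₀ hr, mul_comm] at h₁
  rw [Real.log_le_iff_le_exp hxr, div_le_iff₀ hr, mul_comm] at h₂
  exact ⟨h₁, h₂⟩

end LogCutoffPower


/-- **Unboundedness of the Hardy quadratic form above the sharp constant**
(Euclidean instance of the construction (4.14) proving Corollary 4.1):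
for `n ≥ 3`, `1 < p < n`, `Ω` bounded open containing `0`, and
`λ > ((n−p)/p)^p`, the quotient of the p-energy form of `V = λ‖x‖^{−p}`
is unbounded below on `C_c^∞(Ω \ {0})`. -/
theorem hardy_form_unbounded_below {n : ℕ} (hn : 3 ≤ n) (p : ℝ)
    (hp1 : 1 < p) (hpn : p < n)
    (Ω : Set (EuclideanSpace ℝ (Fin n))) (hΩo : IsOpen Ω)
    (hΩb : Bornology.IsBounded Ω) (h0 : (0 : EuclideanSpace ℝ (Fin n)) ∈ Ω)
    (lam : ℝ) (hlam : ((n - p) / p) ^ p < lam) :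
    ∀ M : ℝ, 0 < M → ∃ φ : EuclideanSpace ℝ (Fin n) → ℝ,
      ContDiff ℝ (⊤ : ℕ∞) φ ∧ HasCompactSupport φ ∧
      tsupport φ ⊆ Ω \ {0} ∧ φ ≠ 0 ∧
      (∫ x in Ω, ‖gradient φ x‖ ^ p) - lam * (∫ x in Ω, |φ x| ^ p / ‖x‖ ^ p) <
        -M * ∫ x in Ω, |φ x| ^ p := by
  intro M hM
  have hp : 0 < p := by linarith
  set a : ℝ := (n - p) / p with ha_def
  have ha : 0 ≤ a := div_nonneg (by linarith) hp.le
  have hap : (-a - 1) * p = -(n : ℝ) := by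
    rw [ha_def]
    field_simp
    ring
  have : Nontrivial (EuclideanSpace ℝ (Fin n)) :=
    Module.nontrivial_of_finrank_pos (R := ℝ) (by rw [finrank_euclideanSpace_fin]; lia)
  obtain ⟨R, hR, hball⟩ := Metric.isOpen_iff.1 hΩo 0 h0
  obtain ⟨r, hMr, hr, hrR⟩ : ∃ r : ℝ, a ^ p < lam - M * r ^ p ∧ 0 < r ∧ r < R := by
    have hcont : Continuous fun r : ℝ => lam - M * r ^ p :=
      continuous_const.sub (continuous_const.mul (Real.continuous_rpow_const hp.le))
    have hev := (hcont.tendsto 0).eventually_const_lt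
      (show a ^ p < lam - M * 0 ^ p by simpa [Real.zero_rpow hp.ne'] using hlam)
    obtain ⟨r, h, hr⟩ := ((hev.filter_mono nhdsWithin_le_nhds).and (Ioo_mem_nhdsGT hR)).exists
    exact ⟨r, h, hr.1, hr.2⟩
  let b : ContDiffBump (-3 / 2 : ℝ) := ⟨1 / 4, 1 / 2, by norm_num, by norm_num⟩
  set χ : ℝ → ℝ := fun s => b s
  have hχ : ContDiff ℝ (⊤ : ℕ∞) χ := b.contDiff
  have hχd : Differentiable ℝ χ := hχ.differentiable (by simp)
  have hχ_supp : Function.support χ ⊆ Set.Ioo (-2) (-1) := by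
    rw [b.support_eq, Real.ball_eq_Ioo]
    exact Set.Ioo_subset_Ioo (by norm_num [b]) (by norm_num [b])
  have hχ_ne : χ ≠ 0 := fun h => by
    have := b.one_of_mem_closedBall (x := -3 / 2) (Metric.mem_closedBall_self b.rIn_pos.le)
    exact one_ne_zero (this.symm.trans (congrFun h _))
  obtain ⟨δ, hδ, hlt⟩ := exists_integral_abs_drift_rpow_lt (hχ.of_le (by simp))
    b.hasCompactSupport hχ_ne hp ha hMr
  set φ : EuclideanSpace ℝ (Fin n) → ℝ := fun x => logCutoffPower χ a δ r ‖x‖ with hφ_def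
  have htsupp : tsupport φ ⊆ _ := tsupport_logCutoffPower_norm_subset hχ_supp hδ hr
  have hsupp_ne {x} (hx : x ∈ tsupport φ) : x ≠ 0 := by
    have h := (htsupp hx).1
    exact norm_pos_iff.1 (lt_of_lt_of_le (by positivity) h)
  have hsupp_le {x} (hx : x ∈ tsupport φ) : ‖x‖ ≤ r :=
    (htsupp hx).2.trans (mul_le_of_le_one_right hr.le
      (Real.exp_le_one_iff.2 (div_nonpos_of_nonpos_of_nonneg (by norm_num) hδ.le)))
  have hsupp_Ω : tsupport φ ⊆ Ω := fun x hx =>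
    hball (mem_ball_zero_iff.2 ((hsupp_le hx).trans_lt hrR))
  -- The two sides of the Hardy quotient, in the logarithmic variable.
  set C : ℝ := n * volume.real (Metric.ball (0 : EuclideanSpace ℝ (Fin n)) 1) * δ⁻¹
  have hC : 0 < C := by
    have : 0 < volume.real (Metric.ball (0 : EuclideanSpace ℝ (Fin n)) 1) :=
      ENNReal.toReal_pos (Metric.measure_ball_pos _ _ one_pos).ne' measure_ball_lt_top.ne
    have : (0 : ℝ) < n := by linarith
    positivity
  have hradial (G : ℝ → ℝ) : ∫ x : EuclideanSpace ℝ (Fin n),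
      ‖x‖ ^ (-(n : ℝ)) * G (δ * Real.log (‖x‖ / r)) = C * ∫ s, G s := by
    simpa using integral_norm_rpow_neg_finrank_mul_comp_log
      (volume : Measure (EuclideanSpace ℝ (Fin n))) hδ hr G
  have hgrad : ∫ x, ‖gradient φ x‖ ^ p = C * ∫ s, |-a * χ s + δ * deriv χ s| ^ p := by
    rw [← hradial fun s => |-a * χ s + δ * deriv χ s| ^ p]
    refine integral_congr_ae ?_
    filter_upwards [compl_mem_ae_iff.2 (measure_singleton (0 : EuclideanSpace ℝ (Fin n)))]
      with x hx
    have hx' : 0 < ‖x‖ := norm_pos_iff.2 hx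
    rw [norm_gradient_comp_norm hx (hasDerivAt_logCutoffPower hχd hr hx'), abs_mul,
      abs_of_pos (Real.rpow_pos_of_pos hx' _),
      Real.mul_rpow (Real.rpow_nonneg hx'.le _) (abs_nonneg _), ← Real.rpow_mul hx'.le, hap]
  have hpot : ∫ x, |φ x| ^ p / ‖x‖ ^ p = C * ∫ s, |χ s| ^ p := by
    rw [← hradial fun s => |χ s| ^ p]
    refine integral_congr_ae ?_
    filter_upwards [compl_mem_ae_iff.2 (measure_singleton (0 : EuclideanSpace ℝ (Fin n)))]
      with x hx
    have hx' : 0 < ‖x‖ := norm_pos_iff.2 hx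
    rw [hφ_def]
    simp only [logCutoffPower]
    rw [abs_mul, abs_of_pos (Real.rpow_pos_of_pos hx' _),
      Real.mul_rpow (Real.rpow_nonneg hx'.le _) (abs_nonneg _), ← Real.rpow_mul hx'.le,
      mul_div_right_comm, ← Real.rpow_sub hx']
    congr 2
    linarith
  have hpot_pos : 0 < ∫ x, |φ x| ^ p / ‖x‖ ^ p := by
    have h₀ : 0 ≤ ∫ s, |-a * χ s + δ * deriv χ s| ^ p :=
      integral_nonneg fun s => by positivity
    have h₁ : 0 < lam - M * r ^ p := (Real.rpow_nonneg ha p).trans_lt hMr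
    rw [hpot]
    exact mul_pos hC (pos_of_mul_pos_right (h₀.trans_lt hlt) h₁.le)
  have hmass : ∫ x, |φ x| ^ p ≤ r ^ p * ∫ x, |φ x| ^ p / ‖x‖ ^ p := by
    rw [← integral_const_mul]
    refine integral_mono_of_nonneg (Filter.Eventually.of_forall fun x => by positivity)
      ((Integrable.of_integral_ne_zero hpot_pos.ne').const_mul _)
      (Filter.Eventually.of_forall fun x => ?_)
    by_cases hx : x ∈ tsupport φ
    · have hx' : 0 < ‖x‖ := norm_pos_iff.2 (hsupp_ne hx)
      have hle : ‖x‖ ^ p ≤ r ^ p := Real.rpow_le_rpow hx'.le (hsupp_le hx) hp.le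
      have hxp : 0 < ‖x‖ ^ p := Real.rpow_pos_of_pos hx' p
      calc |φ x| ^ p = ‖x‖ ^ p * (|φ x| ^ p / ‖x‖ ^ p) := by field_simp
        _ ≤ r ^ p * (|φ x| ^ p / ‖x‖ ^ p) := by gcongr
    · simp [image_eq_zero_of_notMem_tsupport hx, hp.ne']
  have hφ_out {x} (hx : x ∉ Ω) : φ x = 0 :=
    image_eq_zero_of_notMem_tsupport fun h => hx (hsupp_Ω h)
  refine ⟨φ, contDiff_iff_contDiffAt.2 fun x => ?_, ?_,
    fun x hx => ⟨hsupp_Ω hx, hsupp_ne hx⟩, ?_, ?_⟩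
  · by_cases hx : x ∈ tsupport φ
    · exact (contDiffAt_logCutoffPower hχ hr (norm_pos_iff.2 (hsupp_ne hx))).comp x
        (contDiffAt_norm ℝ (hsupp_ne hx))
    · exact contDiffAt_const.congr_of_eventuallyEq
        (notMem_tsupport_iff_eventuallyEq.1 hx)
  · exact Metric.isCompact_of_isClosed_isBounded (isClosed_tsupport φ) (hΩb.subset hsupp_Ω)
  · rintro h
    simp [h, hp.ne'] at hpot_pos
  · rw [setIntegral_eq_integral_of_forall_compl_eq_zero (f := fun x => ‖gradient φ x‖ ^ p)
        fun x hx => ?_,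
      setIntegral_eq_integral_of_forall_compl_eq_zero (f := fun x => |φ x| ^ p / ‖x‖ ^ p)
        fun x hx => by simp [hφ_out hx, hp.ne'],
      setIntegral_eq_integral_of_forall_compl_eq_zero (f := fun x => |φ x| ^ p)
        fun x hx => by simp [hφ_out hx, hp.ne']]
    · have h₁ := mul_lt_mul_of_pos_left hlt hC
      have h₂ := mul_le_mul_of_nonneg_left hmass hM.le
      rw [← hgrad, mul_left_comm, ← hpot] at h₁
      linarith
    · have hfd : fderiv ℝ φ x = 0 := fderiv_of_notMem_tsupport ℝ fun h => hx (hsupp_Ω h)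
      simp [gradient, hfd, hp.ne']
end

section
/- Let n ≥ 1, Q = 2n + 2, 1 < p < Q, let Ω ⊂ ℝ^{2n+1} be a bounded open set with 0 ∈ Ω, let λ > ((Q−p)/p)^p, and set V(z, t) = λ |z|^p / (|z|⁴ + t²)^{p/2} for (z,t) ≠ 0. Then the quadratic-form quotient is unbounded below: for every M > 0 there exists a nonzero φ ∈ C_c^∞(Ω \ {0}) with ∫_Ω ‖∇_H φ‖^p dz dt − ∫_Ω V |φ|^p dz dt < −M ∫_Ω |φ|^p dz dt. -/
open MeasureTheory

/-- A point of the Heisenberg group `Hⁿ ≅ ℝⁿ × ℝⁿ × ℝ`, coordinates `(x, y, t)`. -/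
abbrev Heisenberg (n : ℕ) :=
  EuclideanSpace ℝ (Fin n) × EuclideanSpace ℝ (Fin n) × ℝ

/-- The horizontal vector field `X_j = ∂/∂x_j + 2 y_j ∂/∂t` applied to `f`. -/
noncomputable def heisX {n : ℕ} (j : Fin n) (f : Heisenberg n → ℝ)
    (q : Heisenberg n) : ℝ :=
  fderiv ℝ f q (EuclideanSpace.single j 1, 0, 2 * q.2.1 j)

/-- The horizontal vector field `Y_j = ∂/∂y_j − 2 x_j ∂/∂t` applied to `f`. -/
noncomputable def heisY {n : ℕ} (j : Fin n) (f : Heisenberg n → ℝ)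
    (q : Heisenberg n) : ℝ :=
  fderiv ℝ f q (0, EuclideanSpace.single j 1, -(2 * q.1 j))

/-- Squared norm of the horizontal gradient `∇_H f = (X₁f,…,Xₙf,Y₁f,…,Yₙf)`. -/
noncomputable def heisGradSq {n : ℕ} (f : Heisenberg n → ℝ)
    (q : Heisenberg n) : ℝ :=
  ∑ j : Fin n, ((heisX j f q) ^ 2 + (heisY j f q) ^ 2)

/-- The homogeneous norm `ρ(z,t) = (|z|⁴ + t²)^{1/4}` with `|z|² = ‖x‖² + ‖y‖²`. -/
noncomputable def heisRho {n : ℕ} (q : Heisenberg n) : ℝ :=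
  ((‖q.1‖ ^ 2 + ‖q.2.1‖ ^ 2) ^ 2 + q.2.2 ^ 2) ^ ((1 : ℝ) / 4)

/-- The squared norm `|z|² = |x|² + |y|²` of the horizontal coordinates. -/
noncomputable def heisZSq {n : ℕ} (q : Heisenberg n) : ℝ :=
  ‖q.1‖ ^ 2 + ‖q.2.1‖ ^ 2

/-- The fourth power `|z|⁴ + t²` of the homogeneous norm. -/
noncomputable def heisGauge {n : ℕ} (q : Heisenberg n) : ℝ :=
  (‖q.1‖ ^ 2 + ‖q.2.1‖ ^ 2) ^ 2 + q.2.2 ^ 2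

/-- The logarithm of the homogeneous norm (with value `0` at the origin). -/
noncomputable def heisLogRho {n : ℕ} (q : Heisenberg n) : ℝ :=
  Real.log (heisGauge q) / 4

/-- The Heisenberg dilation `(z, t) ↦ (r z, r² t)`. -/
noncomputable def heisDil {n : ℕ} (r : ℝ) : Heisenberg n → Heisenberg n :=
  Prod.map (fun x => r • x) (Prod.map (fun y => r • y) (fun t => r ^ 2 • t))

/-- The density `|z|ᵃ ρ^{-(Q + a)}`, homogeneous of degree `-Q` under dilations. -/
noncomputable def heisDensity {n : ℕ} (a : ℝ) (q : Heisenberg n) : ℝ :=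
  Real.sqrt (heisZSq q) ^ a * heisGauge q ^ (-((2 * n + 2 + a) / 4))

lemma heisZSq_nonneg {n : ℕ} (q : Heisenberg n) : 0 ≤ heisZSq q := by
  unfold heisZSq; positivity

lemma heisGauge_nonneg {n : ℕ} (q : Heisenberg n) : 0 ≤ heisGauge q := by
  unfold heisGauge; positivity

lemma heisGauge_zero {n : ℕ} : heisGauge (0 : Heisenberg n) = 0 := by
  simp [heisGauge]

lemma heisGauge_pos {n : ℕ} {q : Heisenberg n} (hq : q ≠ 0) : 0 < heisGauge q := by
  refine (heisGauge_nonneg q).lt_of_ne fun h => hq ?_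
  have h' : (‖q.1‖ ^ 2 + ‖q.2.1‖ ^ 2) ^ 2 + q.2.2 ^ 2 = 0 := h.symm
  have hz : ‖q.1‖ ^ 2 + ‖q.2.1‖ ^ 2 = 0 := by
    nlinarith [sq_nonneg (‖q.1‖ ^ 2 + ‖q.2.1‖ ^ 2), sq_nonneg q.2.2]
  have ht : q.2.2 = 0 := by rw [hz] at h'; simpa using h'
  have hx : q.1 = 0 := by
    rw [← norm_eq_zero]; nlinarith [sq_nonneg ‖q.1‖, sq_nonneg ‖q.2.1‖]
  have hy : q.2.1 = 0 := by
    rw [← norm_eq_zero]; nlinarith [sq_nonneg ‖q.1‖, sq_nonneg ‖q.2.1‖]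
  exact Prod.ext hx (Prod.ext hy ht)

lemma contDiff_heisGauge {n : ℕ} {k : WithTop ℕ∞} :
    ContDiff ℝ k (heisGauge : Heisenberg n → ℝ) := by
  unfold heisGauge
  exact ((((contDiff_norm_sq ℝ).comp contDiff_fst).add
    ((contDiff_norm_sq ℝ).comp (contDiff_fst.comp contDiff_snd))).pow 2).add
    ((contDiff_snd.comp contDiff_snd).pow 2)

lemma continuous_heisGauge {n : ℕ} : Continuous (heisGauge : Heisenberg n → ℝ) :=
  contDiff_heisGauge (k := 0).continuous

lemma continuous_heisZSq {n : ℕ} : Continuous (heisZSq : Heisenberg n → ℝ) := by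
  unfold heisZSq; fun_prop

lemma measurable_heisLogRho {n : ℕ} : Measurable (heisLogRho : Heisenberg n → ℝ) :=
  (Real.measurable_log.comp continuous_heisGauge.measurable).div_const 4

lemma measurable_heisDensity {n : ℕ} (a : ℝ) :
    Measurable (heisDensity a : Heisenberg n → ℝ) :=
  (continuous_heisZSq.measurable.sqrt.pow_const a).mul
    (continuous_heisGauge.measurable.pow_const _)

lemma heisDensity_nonneg {n : ℕ} (a : ℝ) (q : Heisenberg n) : 0 ≤ heisDensity a q :=
  mul_nonneg (Real.rpow_nonneg (Real.sqrt_nonneg _) _)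
    (Real.rpow_nonneg (heisGauge_nonneg q) _)

lemma heisDensity_zero {n : ℕ} {a : ℝ} (ha : 0 ≤ a) :
    heisDensity a (0 : Heisenberg n) = 0 := by
  rw [heisDensity, heisGauge_zero, Real.zero_rpow, mul_zero]
  have : (0 : ℝ) < (2 * n + 2 + a) / 4 := by positivity
  linarith

lemma exp_mul_heisLogRho {n : ℕ} (b : ℝ) {q : Heisenberg n} (hq : q ≠ 0) :
    Real.exp (b * heisLogRho q) = heisGauge q ^ (b / 4) := by
  rw [Real.rpow_def_of_pos (heisGauge_pos hq), heisLogRho]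
  congr 1; ring

lemma heisZSq_heisDil {n : ℕ} (r : ℝ) (q : Heisenberg n) :
    heisZSq (heisDil r q) = r ^ 2 * heisZSq q := by
  simp only [heisZSq, heisDil, Prod.map, norm_smul, mul_pow, Real.norm_eq_abs, sq_abs]
  ring

lemma heisGauge_heisDil {n : ℕ} (r : ℝ) (q : Heisenberg n) :
    heisGauge (heisDil r q) = r ^ 4 * heisGauge q := by
  simp only [heisGauge, heisDil, Prod.map, norm_smul, mul_pow, Real.norm_eq_abs, sq_abs,
    smul_eq_mul]
  ring

lemma heisLogRho_heisDil {n : ℕ} {r : ℝ} (hr : 0 < r) {q : Heisenberg n} (hq : q ≠ 0) :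
    heisLogRho (heisDil r q) = Real.log r + heisLogRho q := by
  rw [heisLogRho, heisLogRho, heisGauge_heisDil,
    Real.log_mul (by positivity) (heisGauge_pos hq).ne', Real.log_pow]
  push_cast; ring

lemma heisDensity_heisDil {n : ℕ} (a : ℝ) {r : ℝ} (hr : 0 < r) (q : Heisenberg n) :
    heisDensity a (heisDil r q) = (r ^ (2 * n + 2))⁻¹ * heisDensity a q := by
  rw [heisDensity, heisDensity, heisZSq_heisDil, heisGauge_heisDil,
    Real.sqrt_mul (by positivity), Real.sqrt_sq hr.le,
    Real.mul_rpow hr.le (Real.sqrt_nonneg _),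
    Real.mul_rpow (by positivity) (heisGauge_nonneg q)]
  have h : r ^ a * (r ^ 4) ^ (-((2 * n + 2 + a) / 4)) = (r ^ (2 * n + 2))⁻¹ := by
    rw [← Real.rpow_natCast r 4, ← Real.rpow_mul hr.le, ← Real.rpow_add hr,
      ← Real.rpow_natCast r (2 * n + 2), ← Real.rpow_neg hr.le]
    congr 1; push_cast; ring
  rw [← h]; ring

lemma measurable_heisDil {n : ℕ} (r : ℝ) :
    Measurable (heisDil r : Heisenberg n → Heisenberg n) :=
  (measurable_const_smul r).prodMap
    ((measurable_const_smul r).prodMap (measurable_const_smul (r ^ 2)))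

lemma map_heisDil_volume {n : ℕ} {r : ℝ} (hr : 0 < r) :
    Measure.map (heisDil r : Heisenberg n → Heisenberg n) volume =
      ENNReal.ofReal (r ^ (2 * n + 2))⁻¹ • volume := by
  have hE := Measure.map_addHaar_smul (volume : Measure (EuclideanSpace ℝ (Fin n))) hr.ne'
  have hR := Measure.map_addHaar_smul (volume : Measure ℝ) (pow_pos hr 2).ne'
  rw [finrank_euclideanSpace_fin, abs_of_nonneg (by positivity)] at hE
  rw [Module.finrank_self, pow_one, abs_of_nonneg (by positivity)] at hR
  rw [Measure.volume_eq_prod, Measure.volume_eq_prod]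
  unfold heisDil
  rw [← Measure.map_prod_map _ _ (by fun_prop) (by fun_prop),
    ← Measure.map_prod_map _ _ (by fun_prop) (by fun_prop), hE, hR]
  simp only [Measure.prod_smul_left, Measure.prod_smul_right, smul_smul]
  rw [← ENNReal.ofReal_mul (by positivity), ← ENNReal.ofReal_mul (by positivity)]
  congr 2
  rw [← mul_inv, ← mul_inv]; ring

/-- The distribution of `log ρ` under the measure with density `|z|ᵃ ρ^{-(Q + a)}`. -/
noncomputable def heisRadial (n : ℕ) (a : ℝ) : Measure ℝ :=
  Measure.map heisLogRho
    ((volume : Measure (Heisenberg n)).withDensity fun q => ENNReal.ofReal (heisDensity a q))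

lemma heisRadial_apply {n : ℕ} (a : ℝ) {A : Set ℝ} (hA : MeasurableSet A) :
    heisRadial n a A = ∫⁻ q : Heisenberg n,
      A.indicator (fun _ => 1) (heisLogRho q) * ENNReal.ofReal (heisDensity a q) := by
  rw [heisRadial, Measure.map_apply measurable_heisLogRho hA,
    withDensity_apply _ (measurable_heisLogRho hA),
    ← lintegral_indicator (measurable_heisLogRho hA)]
  refine lintegral_congr fun q => ?_
  by_cases h : heisLogRho q ∈ A <;> simp [h]

lemma isAddLeftInvariant_heisRadial {n : ℕ} {a : ℝ} (ha : 0 ≤ a) :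
    (heisRadial n a).IsAddLeftInvariant := by
  rw [← forall_measure_preimage_add_iff]
  intro g A hA
  set r := Real.exp g with hr_def
  have hr : 0 < r := Real.exp_pos g
  have hm : Measurable fun q : Heisenberg n =>
      A.indicator (fun _ => (1 : ENNReal)) (heisLogRho q) *
        ENNReal.ofReal (heisDensity a q) :=
    ((measurable_const.indicator hA).comp measurable_heisLogRho).mul
      (measurable_heisDensity a).ennreal_ofReal
  have key := lintegral_map (μ := volume) hm (measurable_heisDil (n := n) r)
  rw [map_heisDil_volume hr, lintegral_smul_measure] at key
  rw [heisRadial_apply a hA, heisRadial_apply a (measurable_const_add g hA)]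
  have hc0 : ENNReal.ofReal (r ^ (2 * n + 2))⁻¹ ≠ 0 := by
    rw [Ne, ENNReal.ofReal_eq_zero, not_le]; positivity
  refine (ENNReal.mul_right_inj hc0 ENNReal.ofReal_ne_top).1 ?_
  rw [smul_eq_mul] at key
  rw [key, ← lintegral_const_mul' _ _ ENNReal.ofReal_ne_top]
  refine lintegral_congr fun q => ?_
  rcases eq_or_ne q 0 with rfl | hq
  · rw [heisDensity_heisDil a hr, heisDensity_zero ha]; simp
  · rw [heisDensity_heisDil a hr, heisLogRho_heisDil hr hq, hr_def, Real.log_exp,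
      ENNReal.ofReal_mul (by positivity)]
    by_cases h : g + heisLogRho q ∈ A <;> simp [h]

lemma isCompact_heisGauge_preimage {n : ℕ} (c d : ℝ) :
    IsCompact {q : Heisenberg n | heisGauge q ∈ Set.Icc c d} := by
  refine Metric.isCompact_of_isClosed_isBounded
    (isClosed_Icc.preimage continuous_heisGauge) ?_
  refine (Metric.isBounded_closedBall (x := (0 : Heisenberg n)) (r := 1 + d)).subset ?_
  intro q hq
  have hd : (‖q.1‖ ^ 2 + ‖q.2.1‖ ^ 2) ^ 2 + q.2.2 ^ 2 ≤ d := hq.2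
  have h1 := sq_nonneg (‖q.1‖ ^ 2 + ‖q.2.1‖ ^ 2 - 1 / 2)
  have h2 := sq_nonneg q.2.2
  have h3 := sq_nonneg (‖q.1‖ - 1 / 2)
  have h4 := sq_nonneg (‖q.2.1‖ - 1 / 2)
  have h5 := sq_nonneg ‖q.1‖
  have h6 := sq_nonneg ‖q.2.1‖
  have h7 := sq_nonneg (|q.2.2| - 1 / 2)
  have h8 := sq_abs q.2.2
  rw [mem_closedBall_zero_iff, Prod.norm_def, Prod.norm_def, Real.norm_eq_abs]
  refine max_le ?_ (max_le ?_ ?_) <;> nlinarith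

lemma heisGauge_mem_Icc {n : ℕ} {q : Heisenberg n} (hq : q ≠ 0) {c d : ℝ} :
    heisLogRho q ∈ Set.Icc c d ↔
      heisGauge q ∈ Set.Icc (Real.exp (4 * c)) (Real.exp (4 * d)) := by
  rw [Set.mem_Icc, Set.mem_Icc, ← Real.le_log_iff_exp_le (heisGauge_pos hq),
    ← Real.log_le_iff_le_exp (heisGauge_pos hq), heisLogRho]
  constructor <;> rintro ⟨h1, h2⟩ <;> constructor <;> linarith

lemma isFiniteMeasureOnCompacts_heisRadial {n : ℕ} {a : ℝ} (ha : 0 ≤ a) :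
    IsFiniteMeasureOnCompacts (heisRadial n a) := by
  refine ⟨fun K hK => ?_⟩
  obtain ⟨c, d, hcd⟩ : ∃ c d : ℝ, K ⊆ Set.Icc c d :=
    ⟨sInf K, sSup K, subset_Icc_csInf_csSup hK.bddBelow hK.bddAbove⟩
  refine (measure_mono hcd).trans_lt ?_
  rw [heisRadial_apply a measurableSet_Icc]
  set S := {q : Heisenberg n | heisGauge q ∈ Set.Icc (Real.exp (4 * c)) (Real.exp (4 * d))}
  have hS : IsCompact S := isCompact_heisGauge_preimage _ _
  have hint : IntegrableOn (heisDensity a) S := by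
    refine ContinuousOn.integrableOn_compact hS ?_
    refine ContinuousOn.mul
      ((continuous_heisZSq.sqrt.rpow_const fun _ => Or.inr ha).continuousOn) ?_
    refine continuous_heisGauge.continuousOn.rpow_const fun q hq => Or.inl ?_
    exact ((Real.exp_pos _).trans_le hq.1).ne'
  refine lt_of_le_of_lt ?_ hint.lintegral_lt_top
  rw [← lintegral_indicator hS.measurableSet]
  refine lintegral_mono fun q => ?_
  rcases eq_or_ne q 0 with rfl | hq
  · simp [heisDensity_zero ha]
  · have := heisGauge_mem_Icc hq (c := c) (d := d)
    by_cases h : q ∈ S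
    · by_cases h' : heisLogRho q ∈ Set.Icc c d <;> simp [h, h', -Set.mem_Icc]
    · have h' : heisLogRho q ∉ Set.Icc c d := fun h' => h (this.1 h')
      simp [h, h', -Set.mem_Icc]

lemma heisRadial_ne_zero {n : ℕ} (hn : 1 ≤ n) {a : ℝ} : heisRadial n a ≠ 0 := by
  intro h
  have h1 := heisRadial_apply (n := n) a MeasurableSet.univ
  rw [h] at h1
  simp only [Measure.coe_zero, Pi.zero_apply, Set.indicator_univ, one_mul] at h1
  rw [eq_comm, lintegral_eq_zero_iff (measurable_heisDensity a).ennreal_ofReal] at h1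
  have hopen : IsOpen {q : Heisenberg n | q.1 ≠ 0} :=
    isOpen_ne.preimage continuous_fst
  have hne : {q : Heisenberg n | q.1 ≠ 0}.Nonempty :=
    ⟨(EuclideanSpace.single ⟨0, hn⟩ 1, 0, 0), by simp⟩
  refine (hopen.measure_pos volume hne).ne' (measure_mono_null ?_ (ae_iff.1 h1))
  intro q hq
  have hq0 : q ≠ 0 := fun h => hq (by rw [h]; rfl)
  have hz : 0 < heisZSq q := by
    have := norm_pos_iff.2 hq
    unfold heisZSq; positivity
  have : 0 < heisDensity a q :=
    mul_pos (Real.rpow_pos_of_pos (Real.sqrt_pos.2 hz) _)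
      (Real.rpow_pos_of_pos (heisGauge_pos hq0) _)
  simpa using this

/-- Polar coordinates: integrals of radial functions against a homogeneous density reduce to
one-dimensional Lebesgue integrals in the variable `log ρ`. -/
lemma exists_integral_heisDensity_mul (n : ℕ) {a : ℝ} (ha : 0 ≤ a) :
    ∃ C : ℝ, (1 ≤ n → 0 < C) ∧ ∀ G : ℝ → ℝ, Continuous G →
      ∫ q : Heisenberg n, heisDensity a q * G (heisLogRho q) = C * ∫ s, G s := by
  have := isAddLeftInvariant_heisRadial (n := n) ha
  have := isFiniteMeasureOnCompacts_heisRadial (n := n) ha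
  have hμ := Measure.isAddLeftInvariant_eq_smul (heisRadial n a) (volume : Measure ℝ)
  set c := (heisRadial n a).addHaarScalarFactor (volume : Measure ℝ)
  refine ⟨c, fun hn => ?_, fun G hG => ?_⟩
  · refine NNReal.coe_pos.2 (pos_iff_ne_zero.2 fun hc => heisRadial_ne_zero (a := a) hn ?_)
    rw [hμ, hc, zero_smul]
  · have h1 : ∫ s, G s ∂heisRadial n a = c * ∫ s, G s := by
      rw [hμ, integral_smul_nnreal_measure, NNReal.smul_def, smul_eq_mul]
    rw [← h1, heisRadial, integral_map measurable_heisLogRho.aemeasurable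
      hG.aestronglyMeasurable, integral_withDensity_eq_integral_toReal_smul
      (measurable_heisDensity a).ennreal_ofReal
      (Filter.Eventually.of_forall fun _ => ENNReal.ofReal_lt_top)]
    simp only [ENNReal.toReal_ofReal (heisDensity_nonneg a _), smul_eq_mul]

lemma fderiv_heisGauge_apply {n : ℕ} (q v : Heisenberg n) :
    fderiv ℝ heisGauge q v =
      4 * heisZSq q * (inner ℝ q.1 v.1 + inner ℝ q.2.1 v.2.1) + 2 * q.2.2 * v.2.2 := by
  have h1 := (hasFDerivAt_fst (𝕜 := ℝ) (p := q)).norm_sq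
  have h2 := (hasFDerivAt_snd (𝕜 := ℝ) (p := q)).fst.norm_sq
  have h3 := (hasFDerivAt_snd (𝕜 := ℝ) (p := q)).snd
  have h : HasFDerivAt (heisGauge : Heisenberg n → ℝ) _ q := ((h1.add h2).pow 2).add (h3.pow 2)
  rw [h.fderiv]
  simp [heisZSq]
  ring

lemma heisGradSq_heisGauge {n : ℕ} (q : Heisenberg n) :
    heisGradSq heisGauge q = 16 * heisZSq q * heisGauge q := by
  have hX (j : Fin n) :
      heisX j heisGauge q = 4 * heisZSq q * q.1 j + 4 * q.2.2 * q.2.1 j := by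
    rw [heisX, fderiv_heisGauge_apply]
    simp [EuclideanSpace.inner_single_right]
    ring
  have hY (j : Fin n) :
      heisY j heisGauge q = 4 * heisZSq q * q.2.1 j - 4 * q.2.2 * q.1 j := by
    rw [heisY, fderiv_heisGauge_apply]
    simp [EuclideanSpace.inner_single_right]
    ring
  have hz : heisZSq q = ∑ j, (q.1 j ^ 2 + q.2.1 j ^ 2) := by
    rw [heisZSq, EuclideanSpace.real_norm_sq_eq, EuclideanSpace.real_norm_sq_eq,
      Finset.sum_add_distrib]
  have hN : heisGauge q = heisZSq q ^ 2 + q.2.2 ^ 2 := rfl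
  have : heisGradSq heisGauge q =
      16 * (heisZSq q ^ 2 + q.2.2 ^ 2) * ∑ j, (q.1 j ^ 2 + q.2.1 j ^ 2) := by
    rw [heisGradSq, Finset.mul_sum]
    refine Finset.sum_congr rfl fun j _ => ?_
    rw [hX, hY]; ring
  rw [this, ← hz, hN]; ring

/-- The eikonal identity `|∇_H (F ∘ log ρ)| = |F'| |z| / ρ²`. -/
lemma heisGradSq_comp_heisLogRho {n : ℕ} {F : ℝ → ℝ} {F' : ℝ} {q : Heisenberg n}
    (hq : q ≠ 0) (hF : HasDerivAt F F' (heisLogRho q)) :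
    heisGradSq (fun q => F (heisLogRho q)) q = F' ^ 2 * heisZSq q / heisGauge q := by
  have hN := heisGauge_pos hq
  have hd : HasFDerivAt heisGauge (fderiv ℝ heisGauge q) q :=
    ((contDiff_heisGauge (k := 1)).differentiable (by norm_num) q).hasFDerivAt
  have hL : HasFDerivAt heisLogRho ((4 : ℝ)⁻¹ • (heisGauge q)⁻¹ • fderiv ℝ heisGauge q) q := by
    have := (hd.log hN.ne').const_smul (4 : ℝ)⁻¹
    refine this.congr_of_eventuallyEq (Filter.Eventually.of_forall fun x => ?_)
    simp [heisLogRho]; ring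
  have hfd := (hF.comp_hasFDerivAt q hL).fderiv
  have h : heisGradSq (fun q => F (heisLogRho q)) q =
      (F' / (4 * heisGauge q)) ^ 2 * heisGradSq heisGauge q := by
    change fderiv ℝ (fun q => F (heisLogRho q)) q = _ at hfd
    simp only [heisGradSq, heisX, heisY, hfd, Finset.mul_sum]
    refine Finset.sum_congr rfl fun j _ => ?_
    simp only [smul_apply, smul_eq_mul]
    field_simp
  rw [h, heisGradSq_heisGauge]
  field_simp
  ring

/-- A compactly supported profile whose shifted derivative has small `p`-energy. -/
lemma exists_profile {p α lam : ℝ} (hp : 0 < p) (hα : 0 ≤ α) (hlam : α ^ p < lam) :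
    ∃ (η : ℝ → ℝ) (R : ℝ), ContDiff ℝ (⊤ : ℕ∞) η ∧
      (∀ s, R < |s| → η s = 0 ∧ deriv η s = 0) ∧
      ∫ s, |deriv η s - α * η s| ^ p < lam * ∫ s, |η s| ^ p := by
  let χ : ContDiffBump (0 : ℝ) := ⟨1, 2, by norm_num, by norm_num⟩
  have hχ : ContDiff ℝ (⊤ : ℕ∞) χ := χ.contDiff
  have hdχ : Continuous (deriv χ) := hχ.continuous_deriv (by norm_num)
  have hsupp (s : ℝ) (hs : s ∉ Set.Icc (-2 : ℝ) 2) : χ s = 0 ∧ deriv χ s = 0 := by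
    have hs' : s ∉ tsupport χ := by
      rw [χ.tsupport_eq, Real.closedBall_eq_Icc]; simpa [χ] using hs
    exact ⟨image_eq_zero_of_notMem_tsupport hs',
      image_eq_zero_of_notMem_tsupport fun h => hs' (tsupport_deriv_subset h)⟩
  let E : ℝ → ℝ → ℝ := fun ε s => |ε * deriv χ s - α * χ s| ^ p
  have hE : Continuous fun ε => ∫ s in Set.Icc (-2 : ℝ) 2, E ε s := by
    refine continuous_parametric_integral_of_continuous ?_ isCompact_Icc
    refine Continuous.rpow_const ?_ fun _ => Or.inr hp.le
    have := hχ.continuous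
    fun_prop
  have hE' (ε : ℝ) : ∫ s in Set.Icc (-2 : ℝ) 2, E ε s = ∫ s, E ε s := by
    refine setIntegral_eq_integral_of_forall_compl_eq_zero fun s hs => ?_
    simp [E, hsupp s hs, hp.ne']
  simp only [hE'] at hE
  have hpos : 0 < ∫ s, |χ s| ^ p := by
    have hc : Continuous fun s => |χ s| ^ p :=
      hχ.continuous.abs.rpow_const fun _ => Or.inr hp.le
    refine hc.integral_pos_of_hasCompactSupport_nonneg_nonzero ?_ ?_ (x := 0) ?_
    · exact HasCompactSupport.intro (isCompact_Icc (a := (-2 : ℝ)) (b := 2)) fun s hs => by simp [hsupp s hs, hp.ne']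
    · exact fun s => by positivity
    · have : χ 0 = 1 := χ.one_of_mem_closedBall (by simp [χ])
      simp [this]
  have h0 : ∫ s, E 0 s < lam * ∫ s, |χ s| ^ p := by
    have : ∀ s, E 0 s = α ^ p * |χ s| ^ p := fun s => by
      simp only [E, zero_mul, zero_sub, abs_neg, abs_mul, abs_of_nonneg hα]
      exact Real.mul_rpow hα (abs_nonneg _)
    simp only [this, integral_const_mul]
    exact mul_lt_mul_of_pos_right hlam hpos
  obtain ⟨ε, hεlt, hε⟩ : ∃ ε, (∫ s, E ε s < lam * ∫ s, |χ s| ^ p) ∧ 0 < ε :=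
    (((hE.tendsto 0).eventually_lt_const h0).filter_mono nhdsWithin_le_nhds
      |>.and self_mem_nhdsWithin).exists (f := nhdsWithin 0 (Set.Ioi 0))
  have hder (s : ℝ) : deriv (fun s => χ (ε * s)) s = ε * deriv χ (ε * s) := by
    simpa using deriv_comp_mul_left ε χ s
  refine ⟨fun s => χ (ε * s), 2 / ε, hχ.comp (contDiff_const.mul contDiff_id), ?_, ?_⟩
  · intro s hs
    have : ε * s ∉ Set.Icc (-2 : ℝ) 2 := fun h => by
      rw [Set.mem_Icc, ← abs_le, abs_mul, abs_of_pos hε] at h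
      rw [div_lt_iff₀ hε] at hs
      linarith
    simp [hder, hsupp _ this]
  · simp only [hder]
    rw [Measure.integral_comp_mul_left (E ε) ε,
      Measure.integral_comp_mul_left (fun s => |χ s| ^ p) ε, smul_eq_mul, smul_eq_mul,
      mul_left_comm]
    exact mul_lt_mul_of_pos_left hεlt (by positivity)

lemma exists_heisGauge_le_subset {n : ℕ} {Ω : Set (Heisenberg n)} (hΩ : IsOpen Ω)
    (h0 : (0 : Heisenberg n) ∈ Ω) : ∃ δ > 0, ∀ q, heisGauge q ≤ δ → q ∈ Ω := by
  obtain ⟨r, hr, hrΩ⟩ := Metric.isOpen_iff.1 hΩ 0 h0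
  set m := min r 1 with hm_def
  have hm : 0 < m := lt_min hr one_pos
  have hm1 : m ≤ 1 := min_le_right _ _
  refine ⟨m ^ 4 / 2, by positivity, fun q hq => hrΩ (Metric.ball_subset_ball (min_le_left r 1) ?_)⟩
  have hq' : (‖q.1‖ ^ 2 + ‖q.2.1‖ ^ 2) ^ 2 + q.2.2 ^ 2 ≤ m ^ 4 / 2 := hq
  have hm4 : 0 < m ^ 4 := by positivity
  have hm2 : m ^ 4 ≤ m ^ 2 := pow_le_pow_of_le_one hm.le hm1 (by norm_num)
  have hz : ‖q.1‖ ^ 2 + ‖q.2.1‖ ^ 2 < m ^ 2 := by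
    refine lt_of_pow_lt_pow_left₀ 2 (by positivity) ?_
    nlinarith [sq_nonneg q.2.2]
  rw [mem_ball_zero_iff, Prod.norm_def, Prod.norm_def]
  refine max_lt ?_ (max_lt ?_ ?_)
  · exact lt_of_pow_lt_pow_left₀ 2 hm.le (by nlinarith [sq_nonneg ‖q.2.1‖])
  · exact lt_of_pow_lt_pow_left₀ 2 hm.le (by nlinarith [sq_nonneg ‖q.1‖])
  · rw [Real.norm_eq_abs]
    refine abs_lt_of_sq_lt_sq (by nlinarith [sq_nonneg (‖q.1‖ ^ 2 + ‖q.2.1‖ ^ 2)]) hm.le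

/-- **Unboundedness of the Hardy quadratic form on the Heisenberg group
above the sharp constant** (Heisenberg instance of the construction (4.14)
proving Corollary 4.1): for `Q = 2n+2`, `1 < p < Q`, `Ω ⊂ ℝ^{2n+1}`
bounded open containing `0`, and `λ > ((Q−p)/p)^p`, the quotient of the
horizontal p-energy form of `V(z,t) = λ|z|^p/(|z|⁴+t²)^{p/2}` is unbounded
below on `C_c^∞(Ω \ {0})`. -/
theorem heisenberg_hardy_form_unbounded_below (n : ℕ) (hn : 1 ≤ n) (p : ℝ)
    (hp1 : 1 < p) (hpQ : p < 2 * n + 2)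
    (Ω : Set (Heisenberg n)) (hΩo : IsOpen Ω)
    (hΩb : Bornology.IsBounded Ω) (h0 : (0 : Heisenberg n) ∈ Ω)
    (lam : ℝ) (hlam : ((2 * n + 2 - p) / p) ^ p < lam) :
    ∀ M : ℝ, 0 < M → ∃ φ : Heisenberg n → ℝ,
      ContDiff ℝ (⊤ : ℕ∞) φ ∧ HasCompactSupport φ ∧
      tsupport φ ⊆ Ω \ {0} ∧ φ ≠ 0 ∧
      (∫ q in Ω, (Real.sqrt (heisGradSq φ q)) ^ p) -
          (∫ q in Ω,
            lam * (Real.sqrt (‖q.1‖ ^ 2 + ‖q.2.1‖ ^ 2)) ^ p /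
              ((‖q.1‖ ^ 2 + ‖q.2.1‖ ^ 2) ^ 2 + q.2.2 ^ 2) ^ (p / 2) *
                |φ q| ^ p) <
        -M * ∫ q in Ω, |φ q| ^ p := by
  intro M hM
  have hp : 0 < p := by linarith
  set α : ℝ := (2 * n + 2 - p) / p with hα_def
  have hα : 0 ≤ α := div_nonneg (by linarith) hp.le
  have hαp : α * p = 2 * n + 2 - p := div_mul_cancel₀ _ hp.ne'
  obtain ⟨η, R, hη, hηR, hηlt⟩ := exists_profile hp hα hlam
  have hηc : Continuous η := hη.continuous
  have hdηc : Continuous (deriv η) := hη.continuous_deriv (by norm_num)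
  obtain ⟨C₁, hC₁, hI₁⟩ := exists_integral_heisDensity_mul n hp.le
  obtain ⟨C₀, -, hI₀⟩ := exists_integral_heisDensity_mul n le_rfl
  obtain ⟨δ, hδ, hδΩ⟩ := exists_heisGauge_le_subset hΩo h0
  set A := lam * (∫ s, |η s| ^ p) - ∫ s, |deriv η s - α * η s| ^ p with hA_def
  have hA : 0 < A := sub_pos.2 hηlt
  set K := ∫ s, Real.exp (p * s) * |η s| ^ p with hK_def
  -- Translating the profile far to the left makes the `Lᵖ` norm negligible.
  obtain ⟨T, hTK, hTδ, hTR⟩ : ∃ T : ℝ, M * (C₀ * (Real.exp (-(p * T)) * K)) < C₁ * A ∧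
      Real.exp (4 * (-T + R)) ≤ δ ∧ R < |T| := by
    have hTp : Filter.Tendsto (fun T : ℝ => Real.exp (-(p * T))) Filter.atTop (nhds 0) :=
      Real.tendsto_exp_neg_atTop_nhds_zero.comp (Filter.tendsto_id.const_mul_atTop hp)
    have h1 := ((hTp.mul_const K).const_mul C₀).const_mul M
    rw [zero_mul, mul_zero, mul_zero] at h1
    refine ((h1.eventually_lt_const (mul_pos (hC₁ hn) hA)).and
      ((Filter.eventually_ge_atTop (R - Real.log δ / 4)).and
        (Filter.eventually_gt_atTop R))).exists.imp fun T hT => ⟨hT.1, ?_, ?_⟩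
    · rw [← Real.le_log_iff_exp_le hδ]; linarith [hT.2.1]
    · exact hT.2.2.trans_le (le_abs_self T)
  set F : ℝ → ℝ := fun s => Real.exp (-(α * s)) * η (s + T) with hF_def
  set φ : Heisenberg n → ℝ := fun q => F (heisLogRho q) with hφ_def
  set S := {q : Heisenberg n | heisGauge q ∈
    Set.Icc (Real.exp (4 * (-T - R))) (Real.exp (4 * (-T + R)))} with hS_def
  have hS : IsCompact S := isCompact_heisGauge_preimage _ _
  have h0S : (0 : Heisenberg n) ∉ S := fun h => by
    have := h.1
    rw [heisGauge_zero] at this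
    exact (Real.exp_pos _).not_ge this
  have hSΩ : S ⊆ Ω \ {0} := fun q hq =>
    ⟨hδΩ q (hq.2.trans hTδ), fun h => h0S (Set.mem_singleton_iff.1 h ▸ hq)⟩
  have hvan (q : Heisenberg n) (hq : q ∉ S) :
      η (heisLogRho q + T) = 0 ∧ deriv η (heisLogRho q + T) = 0 := by
    refine hηR _ ?_
    rcases eq_or_ne q 0 with rfl | hq0
    · simpa [heisLogRho, heisGauge_zero] using hTR
    · refine lt_of_not_ge fun h => hq ((heisGauge_mem_Icc hq0).1 ?_)
      rw [abs_le] at h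
      exact ⟨by linarith [h.1], by linarith [h.2]⟩
  have hφS (q : Heisenberg n) (hq : q ∉ S) : φ q = 0 := by simp [hφ_def, hF_def, hvan q hq]
  have hφ0 : φ =ᶠ[nhds 0] fun _ => 0 := by
    filter_upwards [hS.isClosed.isOpen_compl.mem_nhds h0S] with q hq using hφS q hq
  have hFs : ContDiff ℝ (⊤ : ℕ∞) F :=
    (Real.contDiff_exp.comp (contDiff_const.mul contDiff_id).neg).mul
      (hη.comp (contDiff_id.add contDiff_const))
  have hF' (s : ℝ) : HasDerivAt F
      (Real.exp (-(α * s)) * (deriv η (s + T) - α * η (s + T))) s := by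
    have h1 : HasDerivAt (fun s => Real.exp (-(α * s))) (Real.exp (-(α * s)) * -(α * 1)) s :=
      ((hasDerivAt_id s).const_mul α).neg.exp
    have h2 : HasDerivAt (fun s => η (s + T)) (deriv η (s + T)) s :=
      ((hη.differentiable (by norm_num) (s + T)).hasDerivAt).comp_add_const s T
    exact (h1.mul h2).congr_deriv (by ring)
  have habs {q : Heisenberg n} (hq : q ≠ 0) (a : ℝ) :
      |Real.exp (-(α * heisLogRho q)) * a| ^ p =
        heisGauge q ^ (-((2 * n + 2 - p) / 4)) * |a| ^ p := by
    rw [abs_mul, Real.mul_rpow (abs_nonneg _) (abs_nonneg _), Real.abs_exp, ← Real.exp_mul,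
      ← neg_div, ← exp_mul_heisLogRho _ hq, ← hαp]
    congr 2; ring
  have hsplit {q : Heisenberg n} (hq : q ≠ 0) :
      heisDensity p q = Real.sqrt (heisZSq q) ^ p / heisGauge q ^ (p / 2) *
        heisGauge q ^ (-((2 * n + 2 - p) / 4)) := by
    rw [heisDensity, div_mul_eq_mul_div, mul_div_assoc, ← Real.rpow_sub (heisGauge_pos hq)]
    congr 2; ring
  have hgrad (q : Heisenberg n) : Real.sqrt (heisGradSq φ q) ^ p = heisDensity p q *
      |deriv η (heisLogRho q + T) - α * η (heisLogRho q + T)| ^ p := by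
    rcases eq_or_ne q 0 with rfl | hq
    · simp [heisDensity_zero hp.le, heisGradSq, heisX, heisY, hφ0.fderiv_eq, hp.ne']
    · have hN := heisGauge_pos hq
      rw [hφ_def, heisGradSq_comp_heisLogRho hq (hF' _), mul_div_assoc,
        Real.sqrt_mul (sq_nonneg _), Real.sqrt_sq_eq_abs,
        Real.mul_rpow (abs_nonneg _) (Real.sqrt_nonneg _), habs hq,
        Real.sqrt_div (heisZSq_nonneg q), Real.div_rpow (Real.sqrt_nonneg _) (Real.sqrt_nonneg _),
        Real.sqrt_eq_rpow (heisGauge q), ← Real.rpow_mul hN.le, hsplit hq,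
        show (1 / 2 : ℝ) * p = p / 2 by ring]
      ring
  have hpot (q : Heisenberg n) : lam * Real.sqrt (heisZSq q) ^ p / heisGauge q ^ (p / 2) *
      |φ q| ^ p = heisDensity p q * (lam * |η (heisLogRho q + T)| ^ p) := by
    rcases eq_or_ne q 0 with rfl | hq
    · simp [heisDensity_zero hp.le, hφS 0 h0S, hp.ne']
    · rw [hφ_def, hF_def, habs hq, hsplit hq]; ring
  have hmass (q : Heisenberg n) : |φ q| ^ p = heisDensity 0 q *
      (Real.exp (p * heisLogRho q) * |η (heisLogRho q + T)| ^ p) := by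
    rcases eq_or_ne q 0 with rfl | hq
    · simp [heisDensity_zero, hφS 0 h0S, hp.ne']
    · rw [hφ_def, hF_def, habs hq, heisDensity, Real.rpow_zero, one_mul, ← mul_assoc,
        exp_mul_heisLogRho _ hq, ← Real.rpow_add (heisGauge_pos hq)]
      congr 2; ring
  have hΩS (q : Heisenberg n) (hq : q ∉ Ω) : q ∉ S := fun h => hq (hSΩ h).1
  have e₁ : ∫ q in Ω, Real.sqrt (heisGradSq φ q) ^ p =
      C₁ * ∫ s, |deriv η s - α * η s| ^ p := by
    rw [setIntegral_eq_integral_of_forall_compl_eq_zero fun q hq => by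
      simp [hgrad, hvan q (hΩS q hq), hp.ne']]
    simp only [hgrad]
    rw [hI₁ (fun s => |deriv η (s + T) - α * η (s + T)| ^ p)
      (Continuous.rpow_const (by fun_prop) fun _ => Or.inr hp.le),
      integral_add_right_eq_self (fun s => |deriv η s - α * η s| ^ p)]
  have e₂ : ∫ q in Ω, lam * Real.sqrt (heisZSq q) ^ p / heisGauge q ^ (p / 2) * |φ q| ^ p =
      C₁ * (lam * ∫ s, |η s| ^ p) := by
    rw [setIntegral_eq_integral_of_forall_compl_eq_zero fun q hq => by
      simp [hpot, hvan q (hΩS q hq), hp.ne']]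
    simp only [hpot]
    rw [hI₁ (fun s => lam * |η (s + T)| ^ p)
      (continuous_const.mul (Continuous.rpow_const (by fun_prop) fun _ => Or.inr hp.le)),
      integral_const_mul, integral_add_right_eq_self (fun s => |η s| ^ p)]
  have e₃ : ∫ q in Ω, |φ q| ^ p = C₀ * (Real.exp (-(p * T)) * K) := by
    rw [setIntegral_eq_integral_of_forall_compl_eq_zero fun q hq => by
      simp [hmass, hvan q (hΩS q hq), hp.ne']]
    simp only [hmass]
    rw [hI₀ (fun s => Real.exp (p * s) * |η (s + T)| ^ p)
      ((by fun_prop : Continuous fun s => Real.exp (p * s)).mul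
        (Continuous.rpow_const (by fun_prop) fun _ => Or.inr hp.le)), hK_def,
      ← integral_add_right_eq_self (fun s => Real.exp (p * s) * |η s| ^ p) T,
      ← integral_const_mul (Real.exp (-(p * T)))]
    congr 1
    refine integral_congr_ae (Filter.Eventually.of_forall fun s => ?_)
    dsimp only
    rw [← mul_assoc, ← Real.exp_add]
    congr 2; ring
  have hlt : (∫ q in Ω, Real.sqrt (heisGradSq φ q) ^ p) -
      (∫ q in Ω, lam * Real.sqrt (heisZSq q) ^ p / heisGauge q ^ (p / 2) * |φ q| ^ p) <
        -M * ∫ q in Ω, |φ q| ^ p := by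
    rw [e₁, e₂, e₃]
    rw [hA_def] at hTK
    linarith
  refine ⟨φ, ?_, ?_, ?_, ?_, hlt⟩
  · refine contDiff_iff_contDiffAt.2 fun q => ?_
    rcases eq_or_ne q 0 with rfl | hq
    · exact contDiffAt_const.congr_of_eventuallyEq hφ0
    · exact hFs.contDiffAt.comp q
        ((contDiff_heisGauge.contDiffAt.log (heisGauge_pos hq).ne').div_const 4)
  · exact HasCompactSupport.intro hS hφS
  · refine (closure_minimal (fun q hq => ?_) hS.isClosed).trans hSΩ
    exact by_contra fun h => hq (hφS q h)
  · intro h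
    rw [h] at hlt
    simp [heisGradSq, heisX, heisY, hp.ne'] at hlt
end
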